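/- arXiv:2602.21241 — 6 statements merged into one kernel-verified Lean document; each statement's English description precedes it below -/
import Mathlib

section
/- For any μ ∈ ℝ³ and any direction e ∈ ℝ³ that is not a scalar multiple of (1,1,1), the function t ↦ ln Z(μ + t e) is strictly convex on ℝ. In particular, ln Z is strictly convex when restricted to any affine plane parallel to {x ∈ ℝ³ : x₁ + x₂ + x₃ = 0}. -/
open Real Filter

/-- Integral of a function over the unit sphere `S² ⊂ ℝ³` with respect to the
surface measure, written in spherical coordinates
`m = (sin θ cos φ, sin θ sin φ, cos θ)` with surface element `sin θ dφ dθ`. -/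
noncomputable def sphereIntegral (f : (Fin 3 → ℝ) → ℝ) : ℝ :=
  ∫ θ in (0:ℝ)..Real.pi, ∫ φ in (0:ℝ)..(2 * Real.pi),
    f ![Real.sin θ * Real.cos φ, Real.sin θ * Real.sin φ, Real.cos θ] * Real.sin θ

/-- The Bingham normalizing constant
`Z(μ) = (1/(4π)) ∫_{S²} exp(μ₁ m₁² + μ₂ m₂² + μ₃ m₃²) dσ(m)`. -/
noncomputable def binghamZ (μ : Fin 3 → ℝ) : ℝ :=
  (1 / (4 * Real.pi)) * sphereIntegral (fun m => Real.exp (∑ i, μ i * (m i) ^ 2))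

/-- The second moments of the Bingham distribution:
`zᵢ(μ) = (1/(4π Z(μ))) ∫_{S²} mᵢ² exp(μ₁ m₁² + μ₂ m₂² + μ₃ m₃²) dσ(m)`. -/
noncomputable def binghamZ2 (μ : Fin 3 → ℝ) (i : Fin 3) : ℝ :=
  (1 / (4 * Real.pi * binghamZ μ)) *
    sphereIntegral (fun m => (m i) ^ 2 * Real.exp (∑ j, μ j * (m j) ^ 2))

lemma aux_cont {f : ℝ → ℝ → ℝ} (hf : Continuous (Function.uncurry f)) (a b : ℝ) :
    Continuous fun θ => ∫ φ in a..b, f θ φ :=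
  intervalIntegral.continuous_parametric_intervalIntegral_of_continuous' hf a b

lemma aux_pos {f : ℝ → ℝ → ℝ} (hf : Continuous (Function.uncurry f))
    (h0 : ∀ θ ∈ Set.Icc 0 Real.pi, ∀ φ, 0 ≤ f θ φ)
    (h1 : ∃ θ ∈ Set.Icc 0 Real.pi, ∃ φ ∈ Set.Icc 0 (2 * Real.pi), 0 < f θ φ) :
    0 < ∫ θ in (0:ℝ)..Real.pi, ∫ φ in (0:ℝ)..(2 * Real.pi), f θ φ := by
  obtain ⟨θ, hθ, φ, hφ, h⟩ := h1
  have hpi := Real.pi_pos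
  refine intervalIntegral.integral_pos hpi (aux_cont hf _ _).continuousOn ?_ ⟨θ, hθ, ?_⟩
  · intro x hx
    exact intervalIntegral.integral_nonneg (by positivity)
      (fun u _ => h0 x ⟨hx.1.le, hx.2⟩ u)
  · refine intervalIntegral.integral_pos (by positivity) ?_ (fun u _ => h0 θ hθ u) ⟨φ, hφ, h⟩
    exact (hf.comp (by fun_prop : Continuous fun u : ℝ => (θ, u))).continuousOn

lemma aux_lin {f g h : ℝ → ℝ → ℝ} (hf : Continuous (Function.uncurry f))
    (hg : Continuous (Function.uncurry g)) (hh : Continuous (Function.uncurry h))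
    (p q r a b c d : ℝ) :
    ∫ θ in a..b, ∫ φ in c..d, (p * f θ φ + q * g θ φ - r * h θ φ) =
      p * (∫ θ in a..b, ∫ φ in c..d, f θ φ) + q * (∫ θ in a..b, ∫ φ in c..d, g θ φ)
        - r * (∫ θ in a..b, ∫ φ in c..d, h θ φ) := by
  have key : ∀ (f g h : ℝ → ℝ) (_ : Continuous f) (_ : Continuous g) (_ : Continuous h) (a b : ℝ),
      ∫ x in a..b, (p * f x + q * g x - r * h x) =
        p * (∫ x in a..b, f x) + q * (∫ x in a..b, g x) - r * (∫ x in a..b, h x) := by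
    intro f g h hf hg hh a b
    rw [intervalIntegral.integral_sub, intervalIntegral.integral_add,
      intervalIntegral.integral_const_mul, intervalIntegral.integral_const_mul,
      intervalIntegral.integral_const_mul]
    all_goals exact Continuous.intervalIntegrable (by fun_prop) _ _
  rw [← key _ _ _ (aux_cont hf c d) (aux_cont hg c d) (aux_cont hh c d)]
  congr 1
  ext θ
  have hs : Continuous fun u : ℝ => (θ, u) := by fun_prop
  exact key _ _ _ (hf.comp hs) (hg.comp hs) (hh.comp hs) c d

noncomputable def auxQ (μ : Fin 3 → ℝ) (θ φ : ℝ) : ℝ :=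
  μ 0 * (Real.sin θ * Real.cos φ) ^ 2 + μ 1 * (Real.sin θ * Real.sin φ) ^ 2
    + μ 2 * (Real.cos θ) ^ 2

lemma auxQ_cont (μ : Fin 3 → ℝ) :
    Continuous (Function.uncurry fun θ φ => Real.exp (auxQ μ θ φ) * Real.sin θ) := by
  unfold auxQ Function.uncurry
  fun_prop

lemma binghamZ_eq (μ : Fin 3 → ℝ) : binghamZ μ = (1 / (4 * Real.pi)) *
    ∫ θ in (0:ℝ)..Real.pi, ∫ φ in (0:ℝ)..(2 * Real.pi),
      Real.exp (auxQ μ θ φ) * Real.sin θ := by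
  simp [binghamZ, sphereIntegral, auxQ, Fin.sum_univ_three]

lemma binghamZ_pos' (μ : Fin 3 → ℝ) : 0 < binghamZ μ := by
  have hpi := Real.pi_pos
  rw [binghamZ_eq]
  refine mul_pos (by positivity) (aux_pos (auxQ_cont μ) ?_ ?_)
  · intro θ hθ φ
    exact mul_nonneg (Real.exp_pos _).le (Real.sin_nonneg_of_mem_Icc hθ)
  · refine ⟨Real.pi / 2, ⟨by positivity, by linarith⟩, 0, ⟨le_rfl, by positivity⟩, ?_⟩
    rw [Real.sin_pi_div_two]
    positivity

lemma auxQ_nonconst (e : Fin 3 → ℝ) (he : ¬ ∃ c : ℝ, e = fun _ => c) (K : ℝ) :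
    ∃ θ ∈ Set.Icc 0 Real.pi, ∃ φ ∈ Set.Icc 0 (2 * Real.pi), 0 < Real.sin θ ∧ auxQ e θ φ ≠ K := by
  have hpi := Real.pi_pos
  by_contra! hc
  apply he
  have h0 := hc (Real.pi / 2) ⟨by positivity, by linarith⟩ 0 ⟨le_rfl, by positivity⟩ (by simp)
  have h1 := hc (Real.pi / 2) ⟨by positivity, by linarith⟩ (Real.pi / 2)
    ⟨by positivity, by linarith⟩ (by simp)
  have h2 := hc (Real.pi / 4) ⟨by positivity, by linarith⟩ 0 ⟨le_rfl, by positivity⟩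
    (by rw [Real.sin_pi_div_four]; positivity)
  simp [auxQ] at h0 h1 h2
  have hs : (√2 / 2 : ℝ) ^ 2 = 1 / 2 := by
    rw [div_pow, Real.sq_sqrt (by norm_num)]; norm_num
  rw [hs] at h2
  refine ⟨K, funext fun i => ?_⟩
  fin_cases i
  · exact h0
  · exact h1
  · simp only [Fin.reduceFinMk]; linarith

lemma auxQ_add (μ e : Fin 3 → ℝ) (t θ φ : ℝ) :
    auxQ (μ + t • e) θ φ = auxQ μ θ φ + t * auxQ e θ φ := by
  simp [auxQ]; ring

/-- For any `μ ∈ ℝ³` and any direction `e ∈ ℝ³` that is not a scalar multiple of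
`(1,1,1)`, the function `t ↦ ln Z(μ + t e)` is strictly convex on `ℝ`. -/
theorem logZ_strictConvex_along_directions (μ e : Fin 3 → ℝ)
    (he : ¬ ∃ c : ℝ, e = fun _ => c) :
    StrictConvexOn ℝ Set.univ (fun t : ℝ => Real.log (binghamZ (μ + t • e))) := by
  refine ⟨convex_univ, ?_⟩
  intro s _ t _ hst a b ha hb hab
  simp only [smul_eq_mul]
  have hpi := Real.pi_pos
  have hs := binghamZ_pos' (μ + s • e)
  have ht := binghamZ_pos' (μ + t • e)
  have hm := binghamZ_pos' (μ + (a * s + b * t) • e)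
  set c := Real.log (binghamZ (μ + s • e)) with hc
  set d := Real.log (binghamZ (μ + t • e)) with hd
  rw [Real.log_lt_iff_lt_exp hm]
  have hG : ∀ θ φ : ℝ, a * Real.exp (-c) * (Real.exp (auxQ (μ + s • e) θ φ) * Real.sin θ)
      + b * Real.exp (-d) * (Real.exp (auxQ (μ + t • e) θ φ) * Real.sin θ)
      - Real.exp (-(a * c + b * d)) *
        (Real.exp (auxQ (μ + (a * s + b * t) • e) θ φ) * Real.sin θ)
      = (a * Real.exp (auxQ (μ + s • e) θ φ - c) + b * Real.exp (auxQ (μ + t • e) θ φ - d)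
        - Real.exp (a * (auxQ (μ + s • e) θ φ - c) + b * (auxQ (μ + t • e) θ φ - d)))
          * Real.sin θ := by
    intro θ φ
    have h3 : a * (auxQ (μ + s • e) θ φ - c) + b * (auxQ (μ + t • e) θ φ - d)
        = -(a * c + b * d) + auxQ (μ + (a * s + b * t) • e) θ φ := by
      simp only [auxQ_add]
      linear_combination (auxQ μ θ φ) * hab
    rw [h3, sub_eq_neg_add (auxQ (μ + s • e) θ φ), sub_eq_neg_add (auxQ (μ + t • e) θ φ), Real.exp_add, Real.exp_add,
      Real.exp_add]
    ring
  have hpos := aux_pos (f := fun θ φ =>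
      a * Real.exp (-c) * (Real.exp (auxQ (μ + s • e) θ φ) * Real.sin θ)
      + b * Real.exp (-d) * (Real.exp (auxQ (μ + t • e) θ φ) * Real.sin θ)
      - Real.exp (-(a * c + b * d)) *
        (Real.exp (auxQ (μ + (a * s + b * t) • e) θ φ) * Real.sin θ))
    (by unfold auxQ Function.uncurry; fun_prop)
    (by
      intro θ hθ φ
      simp only [hG]
      refine mul_nonneg ?_ (Real.sin_nonneg_of_mem_Icc hθ)
      have := convexOn_exp.2 (Set.mem_univ (auxQ (μ + s • e) θ φ - c))
        (Set.mem_univ (auxQ (μ + t • e) θ φ - d)) ha.le hb.le hab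
      simp only [smul_eq_mul] at this
      linarith)
    (by
      obtain ⟨θ, hθ, φ, hφ, h1, h2⟩ := auxQ_nonconst e he ((c - d) / (s - t))
      refine ⟨θ, hθ, φ, hφ, ?_⟩
      simp only [hG]
      refine mul_pos ?_ h1
      have hne : auxQ (μ + s • e) θ φ - c ≠ auxQ (μ + t • e) θ φ - d := by
        intro h
        apply h2
        rw [eq_div_iff (sub_ne_zero.2 hst)]
        simp only [auxQ_add] at h
        linarith
      have := strictConvexOn_exp.2 (Set.mem_univ (auxQ (μ + s • e) θ φ - c))
        (Set.mem_univ (auxQ (μ + t • e) θ φ - d)) hne ha hb hab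
      simp only [smul_eq_mul] at this
      linarith)
  rw [aux_lin (auxQ_cont _) (auxQ_cont _) (auxQ_cont _)] at hpos
  have hk := mul_pos (by positivity : 0 < 1 / (4 * Real.pi)) hpos
  have h5 : 0 < a * Real.exp (-c) * binghamZ (μ + s • e) + b * Real.exp (-d) * binghamZ (μ + t • e)
      - Real.exp (-(a * c + b * d)) * binghamZ (μ + (a * s + b * t) • e) := by
    rw [binghamZ_eq (μ + s • e), binghamZ_eq (μ + t • e), binghamZ_eq (μ + (a * s + b * t) • e)]
    linarith
  have hc' : Real.exp (-c) * binghamZ (μ + s • e) = 1 := by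
    rw [Real.exp_neg, hc, Real.exp_log hs, inv_mul_cancel₀ hs.ne']
  have hd' : Real.exp (-d) * binghamZ (μ + t • e) = 1 := by
    rw [Real.exp_neg, hd, Real.exp_log ht, inv_mul_cancel₀ ht.ne']
  rw [mul_assoc, mul_assoc, hc', hd', mul_one, mul_one, hab, Real.exp_neg, sub_pos,
    inv_mul_lt_iff₀ (Real.exp_pos _), mul_one] at h5
  exact h5
end

section
/- For all μ ∈ ℝ³ and indices i, j ∈ {1,2,3}, if μᵢ > μⱼ then zᵢ(μ) > zⱼ(μ). (The second moments of a Bingham distribution are ordered in the same way as the exponents.) -/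
open Real Filter

lemma bh_div_zero (A a B b : ℝ → ℝ → ℝ)
    (hA : ∀ θ φ, HasDerivAt (fun t => A t φ) (a θ φ) θ)
    (hB : ∀ θ φ, HasDerivAt (fun t => B θ t) (b θ φ) φ)
    (ha : Continuous (Function.uncurry a)) (hb : Continuous (Function.uncurry b))
    (hA0 : ∀ φ, A π φ = A 0 φ) (hB0 : ∀ θ, B θ (2 * π) = B θ 0) :
    ∫ θ in (0:ℝ)..π, ∫ φ in (0:ℝ)..(2 * π), (a θ φ + b θ φ) = 0 := by
  have ha1 : ∀ θ, Continuous (fun φ => a θ φ) := fun θ => by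
    exact ha.comp (by fun_prop : Continuous fun φ : ℝ => (θ, φ))
  have hb1 : ∀ θ, Continuous (fun φ => b θ φ) := fun θ => by
    exact hb.comp (by fun_prop : Continuous fun φ : ℝ => (θ, φ))
  have ha2 : ∀ φ, Continuous (fun θ => a θ φ) := fun φ => by
    exact ha.comp (by fun_prop : Continuous fun θ : ℝ => (θ, φ))
  have h1 : ∀ θ, ∫ φ in (0:ℝ)..(2 * π), (a θ φ + b θ φ) = ∫ φ in (0:ℝ)..(2 * π), a θ φ := by
    intro θ
    rw [intervalIntegral.integral_add ((ha1 θ).intervalIntegrable _ _)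
      ((hb1 θ).intervalIntegrable _ _),
      intervalIntegral.integral_eq_sub_of_hasDerivAt (fun φ _ => hB θ φ)
        ((hb1 θ).intervalIntegrable _ _), hB0, sub_self, add_zero]
  have hint : MeasureTheory.IntegrableOn (Function.uncurry a)
      (Set.uIoc 0 π ×ˢ Set.uIoc 0 (2 * π)) :=
    (ha.continuousOn.integrableOn_compact (isCompact_uIcc.prod isCompact_uIcc)).mono_set
      (Set.prod_mono Set.uIoc_subset_uIcc Set.uIoc_subset_uIcc)
  simp_rw [h1]
  rw [MeasureTheory.intervalIntegral_intervalIntegral_swap hint]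
  have h2 : ∀ φ, ∫ θ in (0:ℝ)..π, a θ φ = 0 := by
    intro φ
    rw [intervalIntegral.integral_eq_sub_of_hasDerivAt (fun θ _ => hA θ φ)
        ((ha2 φ).intervalIntegrable _ _), hA0, sub_self]
  simp [h2]

lemma bh_cont {f : (Fin 3 → ℝ) → ℝ} (hf : Continuous f) :
    Continuous (Function.uncurry fun θ φ : ℝ =>
      f ![Real.sin θ * Real.cos φ, Real.sin θ * Real.sin φ, Real.cos θ] * Real.sin θ) := by
  have h : Continuous fun p : ℝ × ℝ =>
      ![Real.sin p.1 * Real.cos p.2, Real.sin p.1 * Real.sin p.2, Real.cos p.1] := by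
    refine continuous_pi fun i => ?_
    fin_cases i <;> simp <;> fun_prop
  simp only [Function.uncurry_def]
  exact (hf.comp h).mul (by fun_prop)

lemma bh_cont1 {f : (Fin 3 → ℝ) → ℝ} (hf : Continuous f) (θ : ℝ) :
    Continuous (fun φ : ℝ =>
      f ![Real.sin θ * Real.cos φ, Real.sin θ * Real.sin φ, Real.cos θ] * Real.sin θ) :=
  Continuous.uncurry_left θ (bh_cont hf)

lemma bh_cont2 {f : (Fin 3 → ℝ) → ℝ} (hf : Continuous f) :
    Continuous (fun θ : ℝ => ∫ φ in (0:ℝ)..(2 * π),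
      f ![Real.sin θ * Real.cos φ, Real.sin θ * Real.sin φ, Real.cos θ] * Real.sin θ) :=
  intervalIntegral.continuous_parametric_intervalIntegral_of_continuous' (bh_cont hf) _ _

lemma bh_pos {f : (Fin 3 → ℝ) → ℝ} (hf : Continuous f) (h0 : ∀ m, 0 ≤ f m)
    (h1 : ∀ m, (∀ i, 0 < m i) → 0 < f m) : 0 < sphereIntegral f := by
  have hpi := Real.pi_pos
  have hs : 0 < Real.sin (π / 4) := by
    rw [Real.sin_pi_div_four]; positivity
  have hc : 0 < Real.cos (π / 4) := by
    rw [Real.cos_pi_div_four]; positivity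
  have hnn : ∀ θ ∈ Set.Ioc 0 π, ∀ φ, 0 ≤
      f ![Real.sin θ * Real.cos φ, Real.sin θ * Real.sin φ, Real.cos θ] * Real.sin θ :=
    fun θ hθ φ => mul_nonneg (h0 _) (Real.sin_nonneg_of_nonneg_of_le_pi hθ.1.le hθ.2)
  unfold sphereIntegral
  refine intervalIntegral.integral_pos hpi (bh_cont2 hf).continuousOn ?_ ?_
  · intro θ hθ
    exact intervalIntegral.integral_nonneg (by positivity) fun φ _ => hnn θ hθ φ
  · refine ⟨π / 4, ⟨by positivity, by linarith⟩, ?_⟩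
    refine intervalIntegral.integral_pos (by positivity) (bh_cont1 hf _).continuousOn ?_ ?_
    · intro φ _
      exact hnn _ ⟨by positivity, by linarith⟩ φ
    · refine ⟨π / 4, ⟨by positivity, by linarith⟩, mul_pos (h1 _ ?_) hs⟩
      intro i
      fin_cases i <;> simp <;> positivity

lemma bh_lin {f g h : (Fin 3 → ℝ) → ℝ} (hf : Continuous f) (hg : Continuous g)
    (hh : Continuous h) (c : ℝ) :
    sphereIntegral (fun m => f m - g m - c * h m) =
      sphereIntegral f - sphereIntegral g - c * sphereIntegral h := by
  have hlin : ∀ (u v w : ℝ → ℝ) (a b : ℝ), Continuous u → Continuous v → Continuous w →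
      ∫ x in a..b, (u x - v x - c * w x) =
        (∫ x in a..b, u x) - (∫ x in a..b, v x) - c * ∫ x in a..b, w x := by
    intro u v w a b hu hv hw
    rw [← intervalIntegral.integral_const_mul, ← intervalIntegral.integral_sub
      (hu.intervalIntegrable _ _) (hv.intervalIntegrable _ _),
      ← intervalIntegral.integral_sub
      (Continuous.intervalIntegrable (by fun_prop) _ _)
      (Continuous.intervalIntegrable (by fun_prop) _ _)]
  unfold sphereIntegral
  rw [← hlin _ _ _ _ _ (bh_cont2 hf) (bh_cont2 hg) (bh_cont2 hh)]
  congr 1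
  ext θ
  rw [← hlin _ _ _ _ _ (bh_cont1 hf θ) (bh_cont1 hg θ) (bh_cont1 hh θ)]
  congr 1
  ext φ
  ring

noncomputable def bhE (p q r θ φ : ℝ) : ℝ :=
  Real.exp (p * (sin θ * cos φ) ^ 2 + q * (sin θ * sin φ) ^ 2 + r * cos θ ^ 2)

lemma bhE_cont (p q r : ℝ) : Continuous fun x : ℝ × ℝ => bhE p q r x.1 x.2 := by
  unfold bhE; fun_prop

lemma bhE_dθ (p q r θ φ : ℝ) : HasDerivAt (fun t => bhE p q r t φ)
    (bhE p q r θ φ * (2 * sin θ * cos θ * (p * cos φ ^ 2 + q * sin φ ^ 2 - r))) θ := by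
  unfold bhE
  have hs := Real.hasDerivAt_sin θ
  have hc := Real.hasDerivAt_cos θ
  convert (((((hs.mul_const (cos φ)).pow 2).const_mul p).add
    (((hs.mul_const (sin φ)).pow 2).const_mul q)).add ((hc.pow 2).const_mul r)).exp using 1
  · rfl
  change _ = Real.exp (p * (sin θ * cos φ) ^ 2 + q * (sin θ * sin φ) ^ 2 + r * cos θ ^ 2) * _
  push_cast
  ring

lemma bhE_dφ (p q r θ φ : ℝ) : HasDerivAt (fun t => bhE p q r θ t)
    (bhE p q r θ φ * (2 * sin θ ^ 2 * sin φ * cos φ * (q - p))) φ := by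
  unfold bhE
  have hs := Real.hasDerivAt_sin φ
  have hc := Real.hasDerivAt_cos φ
  convert (((((hc.const_mul (sin θ)).pow 2).const_mul p).add
    (((hs.const_mul (sin θ)).pow 2).const_mul q)).add
      (hasDerivAt_const φ (r * cos θ ^ 2))).exp using 1
  · rfl
  change _ = Real.exp (p * (sin θ * cos φ) ^ 2 + q * (sin θ * sin φ) ^ 2 + r * cos θ ^ 2) * _
  push_cast
  ring

lemma bh_01 (μ : Fin 3 → ℝ) : sphereIntegral (fun m =>
    (m 0) ^ 2 * Real.exp (∑ k, μ k * (m k) ^ 2) - (m 1) ^ 2 * Real.exp (∑ k, μ k * (m k) ^ 2)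
     - 2 * (μ 0 - μ 1) * ((m 0) ^ 2 * (m 1) ^ 2 * Real.exp (∑ k, μ k * (m k) ^ 2))) = 0 := by
  have hE := bhE_cont (μ 0) (μ 1) (μ 2)
  have key := bh_div_zero (fun _ _ => 0) (fun _ _ => 0)
    (fun θ φ => sin θ ^ 3 * (cos φ * sin φ * bhE (μ 0) (μ 1) (μ 2) θ φ))
    (fun θ φ => sin θ ^ 3 * ((-sin φ * sin φ + cos φ * cos φ) * bhE (μ 0) (μ 1) (μ 2) θ φ
      + cos φ * sin φ * (bhE (μ 0) (μ 1) (μ 2) θ φ *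
        (2 * sin θ ^ 2 * sin φ * cos φ * (μ 1 - μ 0)))))
    (fun θ φ => hasDerivAt_const _ _)
    (fun θ φ => (((Real.hasDerivAt_cos φ).mul (Real.hasDerivAt_sin φ)).mul
      (bhE_dφ _ _ _ θ φ)).const_mul _)
    (by simp only [Function.uncurry_def]; fun_prop)
    (by simp only [Function.uncurry_def]; fun_prop)
    (by simp) (by simp)
  rw [← key]
  unfold sphereIntegral
  congr 1; ext θ; congr 1; ext φ
  simp [Fin.sum_univ_three, bhE]
  ring

lemma bh_02 (μ : Fin 3 → ℝ) : sphereIntegral (fun m =>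
    (m 0) ^ 2 * Real.exp (∑ k, μ k * (m k) ^ 2) - (m 2) ^ 2 * Real.exp (∑ k, μ k * (m k) ^ 2)
     - 2 * (μ 0 - μ 2) * ((m 0) ^ 2 * (m 2) ^ 2 * Real.exp (∑ k, μ k * (m k) ^ 2))) = 0 := by
  have hE := bhE_cont (μ 0) (μ 1) (μ 2)
  have key := bh_div_zero
    (fun θ φ => -cos φ ^ 2 * (sin θ * sin θ * cos θ * bhE (μ 0) (μ 1) (μ 2) θ φ))
    (fun θ φ => -cos φ ^ 2 * (((cos θ * sin θ + sin θ * cos θ) * cos θ + sin θ * sin θ * -sin θ)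
        * bhE (μ 0) (μ 1) (μ 2) θ φ
      + sin θ * sin θ * cos θ * (bhE (μ 0) (μ 1) (μ 2) θ φ *
        (2 * sin θ * cos θ * (μ 0 * cos φ ^ 2 + μ 1 * sin φ ^ 2 - μ 2)))))
    (fun θ φ => (cos θ ^ 2 * sin θ) * (cos φ * sin φ * bhE (μ 0) (μ 1) (μ 2) θ φ))
    (fun θ φ => (cos θ ^ 2 * sin θ) * ((-sin φ * sin φ + cos φ * cos φ) *
        bhE (μ 0) (μ 1) (μ 2) θ φ
      + cos φ * sin φ * (bhE (μ 0) (μ 1) (μ 2) θ φ *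
        (2 * sin θ ^ 2 * sin φ * cos φ * (μ 1 - μ 0)))))
    (fun θ φ => (((((Real.hasDerivAt_sin θ).mul (Real.hasDerivAt_sin θ)).mul
      (Real.hasDerivAt_cos θ)).mul (bhE_dθ _ _ _ θ φ)).const_mul _))
    (fun θ φ => (((Real.hasDerivAt_cos φ).mul (Real.hasDerivAt_sin φ)).mul
      (bhE_dφ _ _ _ θ φ)).const_mul _)
    (by simp only [Function.uncurry_def]; fun_prop)
    (by simp only [Function.uncurry_def]; fun_prop)
    (by simp) (by simp)
  rw [← key]
  unfold sphereIntegral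
  congr 1; ext θ; congr 1; ext φ
  simp only [Fin.sum_univ_three, bhE, Matrix.cons_val]
  generalize Real.exp _ = X
  have h1 := Real.sin_sq φ
  simp only [h1]
  grind

lemma bh_12 (μ : Fin 3 → ℝ) : sphereIntegral (fun m =>
    (m 1) ^ 2 * Real.exp (∑ k, μ k * (m k) ^ 2) - (m 2) ^ 2 * Real.exp (∑ k, μ k * (m k) ^ 2)
     - 2 * (μ 1 - μ 2) * ((m 1) ^ 2 * (m 2) ^ 2 * Real.exp (∑ k, μ k * (m k) ^ 2))) = 0 := by
  have hE := bhE_cont (μ 0) (μ 1) (μ 2)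
  have key := bh_div_zero
    (fun θ φ => -sin φ ^ 2 * (sin θ * sin θ * cos θ * bhE (μ 0) (μ 1) (μ 2) θ φ))
    (fun θ φ => -sin φ ^ 2 * (((cos θ * sin θ + sin θ * cos θ) * cos θ + sin θ * sin θ * -sin θ)
        * bhE (μ 0) (μ 1) (μ 2) θ φ
      + sin θ * sin θ * cos θ * (bhE (μ 0) (μ 1) (μ 2) θ φ *
        (2 * sin θ * cos θ * (μ 0 * cos φ ^ 2 + μ 1 * sin φ ^ 2 - μ 2)))))
    (fun θ φ => (-cos θ ^ 2 * sin θ) * (cos φ * sin φ * bhE (μ 0) (μ 1) (μ 2) θ φ))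
    (fun θ φ => (-cos θ ^ 2 * sin θ) * ((-sin φ * sin φ + cos φ * cos φ) *
        bhE (μ 0) (μ 1) (μ 2) θ φ
      + cos φ * sin φ * (bhE (μ 0) (μ 1) (μ 2) θ φ *
        (2 * sin θ ^ 2 * sin φ * cos φ * (μ 1 - μ 0)))))
    (fun θ φ => (((((Real.hasDerivAt_sin θ).mul (Real.hasDerivAt_sin θ)).mul
      (Real.hasDerivAt_cos θ)).mul (bhE_dθ _ _ _ θ φ)).const_mul _))
    (fun θ φ => (((Real.hasDerivAt_cos φ).mul (Real.hasDerivAt_sin φ)).mul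
      (bhE_dφ _ _ _ θ φ)).const_mul _)
    (by simp only [Function.uncurry_def]; fun_prop)
    (by simp only [Function.uncurry_def]; fun_prop)
    (by simp) (by simp)
  rw [← key]
  unfold sphereIntegral
  congr 1; ext θ; congr 1; ext φ
  simp only [Fin.sum_univ_three, bhE, Matrix.cons_val]
  generalize Real.exp _ = X
  have h1 := Real.sin_sq φ
  grind

lemma bh_diff (μ : Fin 3 → ℝ) (i j : Fin 3)
    (H : sphereIntegral (fun m =>
    (m i) ^ 2 * Real.exp (∑ k, μ k * (m k) ^ 2) - (m j) ^ 2 * Real.exp (∑ k, μ k * (m k) ^ 2)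
     - 2 * (μ i - μ j) * ((m i) ^ 2 * (m j) ^ 2 * Real.exp (∑ k, μ k * (m k) ^ 2))) = 0) :
    ∃ c > 0, sphereIntegral (fun m => (m i) ^ 2 * Real.exp (∑ k, μ k * (m k) ^ 2)) -
      sphereIntegral (fun m => (m j) ^ 2 * Real.exp (∑ k, μ k * (m k) ^ 2)) =
      (μ i - μ j) * c := by
  rw [bh_lin (by fun_prop) (by fun_prop) (by fun_prop)] at H
  refine ⟨2 * sphereIntegral (fun m =>
    (m i) ^ 2 * (m j) ^ 2 * Real.exp (∑ k, μ k * (m k) ^ 2)), ?_, by linarith⟩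
  have := bh_pos (f := fun m =>
    (m i) ^ 2 * (m j) ^ 2 * Real.exp (∑ k, μ k * (m k) ^ 2)) (by fun_prop)
    (fun m => by positivity) (fun m hm => by have := hm i; have := hm j; positivity)
  positivity

/-- The second moments of a Bingham distribution are ordered in the same way as
the exponents: if `μᵢ > μⱼ` then `zᵢ(μ) > zⱼ(μ)`. -/
theorem binghamZ2_strict_order (μ : Fin 3 → ℝ) (i j : Fin 3) (h : μ i > μ j) :
    binghamZ2 μ i > binghamZ2 μ j := by
  have hZ : 0 < binghamZ μ := by
    unfold binghamZ
    have := bh_pos (f := fun m => Real.exp (∑ k, μ k * (m k) ^ 2)) (by fun_prop)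
      (fun m => by positivity) (fun m _ => by positivity)
    have := Real.pi_pos
    positivity
  have hpi := Real.pi_pos
  unfold binghamZ2
  refine mul_lt_mul_of_pos_left ?_ (by positivity)
  obtain ⟨c, hc, h01⟩ := bh_diff μ 0 1 (bh_01 μ)
  obtain ⟨d, hd, h02⟩ := bh_diff μ 0 2 (bh_02 μ)
  obtain ⟨e, he, h12⟩ := bh_diff μ 1 2 (bh_12 μ)
  fin_cases i <;> fin_cases j <;> simp only [Fin.zero_eta, Fin.mk_one, Fin.reduceFinMk] at h ⊢ <;>
    first
    | exact absurd h (lt_irrefl _)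
    | nlinarith [mul_pos (sub_pos.2 h) hc]
    | nlinarith [mul_pos (sub_pos.2 h) hd]
    | nlinarith [mul_pos (sub_pos.2 h) he]
end

section
/- For every q ∈ Δ₀ there exists a unique μ ∈ ℝ³ with μ₁ + μ₂ + μ₃ = 0 such that zᵢ(μ) = qᵢ + 1/3 for i = 1, 2, 3. (This is the existence and uniqueness of the three-dimensional Bingham closure.) -/
open Real Filter

noncomputable def bgJ (h : ℝ → ℝ → ℝ) : ℝ :=
  ∫ θ in (0:ℝ)..Real.pi, ∫ φ in (0:ℝ)..(2 * Real.pi), h θ φ * Real.sin θ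

noncomputable def bgM (θ φ : ℝ) : Fin 3 → ℝ :=
  ![Real.sin θ * Real.cos φ, Real.sin θ * Real.sin φ, Real.cos θ]

theorem bgM_cont (i : Fin 3) : Continuous (fun x : ℝ × ℝ => bgM x.1 x.2 i) := by
  fin_cases i <;> simp [bgM] <;> fun_prop

theorem bgM_sum (θ φ : ℝ) : (bgM θ φ 0)^2 + (bgM θ φ 1)^2 + (bgM θ φ 2)^2 = 1 := by
  simp [bgM]
  nlinarith [Real.sin_sq_add_cos_sq θ, Real.sin_sq_add_cos_sq φ]

theorem bgJ_cont {X : Type*} [TopologicalSpace X] (H : X → ℝ → ℝ → ℝ)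
    (hH : Continuous (fun x : X × ℝ × ℝ => H x.1 x.2.1 x.2.2)) :
    Continuous (fun x => bgJ (H x)) := by
  unfold bgJ
  apply intervalIntegral.continuous_parametric_intervalIntegral_of_continuous'
  apply intervalIntegral.continuous_parametric_intervalIntegral_of_continuous'
  have h1 : Continuous (fun x : (X × ℝ) × ℝ => H x.1.1 x.1.2 x.2) :=
    hH.comp (f := fun x : (X × ℝ) × ℝ => (x.1.1, x.1.2, x.2)) (by fun_prop)
  simp only [Function.uncurry_def]
  exact h1.mul (by fun_prop)

theorem bgIn_cont (h : ℝ → ℝ → ℝ) (hh : Continuous (fun x : ℝ × ℝ => h x.1 x.2)) :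
    Continuous (fun θ => ∫ φ in (0:ℝ)..(2 * Real.pi), h θ φ * Real.sin θ) := by
  apply intervalIntegral.continuous_parametric_intervalIntegral_of_continuous'
  simp only [Function.uncurry_def]
  exact hh.mul (by fun_prop)

theorem bgIn_cont2 (h : ℝ → ℝ → ℝ) (hh : Continuous (fun x : ℝ × ℝ => h x.1 x.2)) (θ : ℝ) :
    Continuous (fun φ => h θ φ * Real.sin θ) :=
  (hh.comp (f := fun φ : ℝ => (θ, φ)) (by fun_prop)).mul continuous_const

theorem bgJ_mul (c : ℝ) (h : ℝ → ℝ → ℝ) : bgJ (fun θ φ => c * h θ φ) = c * bgJ h := by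
  simp only [bgJ, mul_assoc, intervalIntegral.integral_const_mul]

theorem bgJ_sub (h k : ℝ → ℝ → ℝ) (hh : Continuous (fun x : ℝ × ℝ => h x.1 x.2))
    (hk : Continuous (fun x : ℝ × ℝ => k x.1 x.2)) :
    bgJ (fun θ φ => h θ φ - k θ φ) = bgJ h - bgJ k := by
  unfold bgJ
  rw [← intervalIntegral.integral_sub ((bgIn_cont h hh).intervalIntegrable _ _)
    ((bgIn_cont k hk).intervalIntegrable _ _)]
  congr 1; ext θ
  rw [← intervalIntegral.integral_sub ((bgIn_cont2 h hh θ).intervalIntegrable _ _)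
    ((bgIn_cont2 k hk θ).intervalIntegrable _ _)]
  congr 1; ext φ; ring

theorem bgJ_nonneg (h : ℝ → ℝ → ℝ) (h0 : ∀ θ φ, 0 ≤ h θ φ) : 0 ≤ bgJ h := by
  unfold bgJ
  apply intervalIntegral.integral_nonneg Real.pi_pos.le
  intro θ hθ
  apply intervalIntegral.integral_nonneg (by positivity)
  intro φ _
  exact mul_nonneg (h0 _ _) (Real.sin_nonneg_of_mem_Icc hθ)

theorem bgJ_mono (h k : ℝ → ℝ → ℝ) (hh : Continuous (fun x : ℝ × ℝ => h x.1 x.2))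
    (hk : Continuous (fun x : ℝ × ℝ => k x.1 x.2)) (hle : ∀ θ φ, h θ φ ≤ k θ φ) :
    bgJ h ≤ bgJ k := by
  have := bgJ_nonneg (fun θ φ => k θ φ - h θ φ) (fun θ φ => sub_nonneg.2 (hle θ φ))
  rw [bgJ_sub k h hk hh] at this
  linarith

theorem bgJ_zero (h : ℝ → ℝ → ℝ) (hh : Continuous (fun x : ℝ × ℝ => h x.1 x.2))
    (h0 : ∀ θ φ, 0 ≤ h θ φ) (hz : bgJ h ≤ 0) :
    ∀ θ ∈ Set.Icc 0 Real.pi, ∀ φ ∈ Set.Icc 0 (2 * Real.pi), h θ φ = 0 := by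
  intro θ hθ φ hφ
  have key : ∀ θ ∈ Set.Ioo 0 Real.pi, h θ φ = 0 := by
    intro θ hθ
    by_contra hne
    have hpos : 0 < h θ φ := lt_of_le_of_ne (h0 _ _) (Ne.symm hne)
    have hs := Real.sin_pos_of_mem_Ioo hθ
    have hin : 0 < ∫ φ in (0:ℝ)..(2 * Real.pi), h θ φ * Real.sin θ :=
      intervalIntegral.integral_pos (by positivity) (bgIn_cont2 h hh θ).continuousOn
        (fun x _ => mul_nonneg (h0 _ _) hs.le) ⟨φ, hφ, mul_pos hpos hs⟩
    have : 0 < bgJ h :=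
      intervalIntegral.integral_pos Real.pi_pos (bgIn_cont h hh).continuousOn
        (fun x hx => intervalIntegral.integral_nonneg (by positivity) (fun y _ =>
          mul_nonneg (h0 _ _) (Real.sin_nonneg_of_mem_Icc ⟨hx.1.le, hx.2⟩)))
        ⟨θ, ⟨hθ.1.le, hθ.2.le⟩, hin⟩
    linarith
  have hc : Continuous (fun θ => h θ φ) := hh.comp (f := fun θ : ℝ => (θ, φ)) (by fun_prop)
  have hcl := Set.EqOn.closure (f := fun θ => h θ φ) (g := fun _ => (0:ℝ))
    (s := Set.Ioo 0 Real.pi) key hc continuous_const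
  rw [closure_Ioo Real.pi_pos.ne] at hcl
  exact hcl hθ

/-- values at the poles -/
theorem bg_poles (P : (Fin 3 → ℝ) → Prop)
    (hP : ∀ θ ∈ Set.Icc 0 Real.pi, ∀ φ ∈ Set.Icc 0 (2 * Real.pi), P (fun i => (bgM θ φ i)^2)) :
    P ![1,0,0] ∧ P ![0,1,0] ∧ P ![0,0,1] := by
  have hp := Real.pi_pos
  have h1 := hP (Real.pi/2) ⟨by linarith, by linarith⟩ 0 ⟨by linarith, by linarith⟩
  have h2 := hP (Real.pi/2) ⟨by linarith, by linarith⟩ (Real.pi/2) ⟨by linarith, by linarith⟩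
  have h3 := hP 0 ⟨by linarith, by linarith⟩ 0 ⟨by linarith, by linarith⟩
  refine ⟨?_, ?_, ?_⟩
  · convert h1 using 1; ext i; fin_cases i <;> simp [bgM]
  · convert h2 using 1; ext i; fin_cases i <;> simp [bgM]
  · convert h3 using 1; ext i; fin_cases i <;> simp [bgM]

/-- the linear form `w · (t - p)` -/
noncomputable def bgL (p w : Fin 3 → ℝ) (θ φ : ℝ) : ℝ :=
  w 0 * ((bgM θ φ 0)^2 - p 0) + w 1 * ((bgM θ φ 1)^2 - p 1) + w 2 * ((bgM θ φ 2)^2 - p 2)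

theorem bgL_cont (p : Fin 3 → ℝ) :
    Continuous (fun x : (Fin 3 → ℝ) × ℝ × ℝ => bgL p x.1 x.2.1 x.2.2) := by
  unfold bgL
  have h (i : Fin 3) : Continuous (fun x : (Fin 3 → ℝ) × ℝ × ℝ => bgM x.2.1 x.2.2 i) :=
    (bgM_cont i).comp continuous_snd
  have h0 := h 0
  have h1 := h 1
  have h2 := h 2
  fun_prop

theorem bgL_cont' (p w : Fin 3 → ℝ) : Continuous (fun x : ℝ × ℝ => bgL p w x.1 x.2) :=
  (bgL_cont p).comp (f := fun x : ℝ × ℝ => (w, x)) (by fun_prop)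

theorem bgL_zero (p w : Fin 3 → ℝ) (hp : ∀ i, 0 < p i) (hp1 : p 0 + p 1 + p 2 = 1)
    (hw : w 0 + w 1 + w 2 = 0)
    (h : ∀ θ ∈ Set.Icc 0 Real.pi, ∀ φ ∈ Set.Icc 0 (2 * Real.pi), bgL p w θ φ ≤ 0) : w = 0 := by
  obtain ⟨h0, h1, h2⟩ := bg_poles
    (fun t => w 0 * (t 0 - p 0) + w 1 * (t 1 - p 1) + w 2 * (t 2 - p 2) ≤ 0) h
  simp at h0 h1 h2
  have a0 := hp 0
  have a1 := hp 1
  have a2 := hp 2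
  set s := w 0 * p 0 + w 1 * p 1 + w 2 * p 2 with hs
  have b0 : w 0 - s ≤ 0 := by linarith
  have b1 : w 1 - s ≤ 0 := by linarith
  have b2 : w 2 - s ≤ 0 := by linarith
  have hsum : p 0 * (w 0 - s) + p 1 * (w 1 - s) + p 2 * (w 2 - s) = 0 := by
    have : p 0 * (w 0 - s) + p 1 * (w 1 - s) + p 2 * (w 2 - s) = s - (p 0 + p 1 + p 2) * s := by
      rw [hs]; ring
    rw [this, hp1]; ring
  have c0 := mul_nonpos_of_nonneg_of_nonpos a0.le b0
  have c1 := mul_nonpos_of_nonneg_of_nonpos a1.le b1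
  have c2 := mul_nonpos_of_nonneg_of_nonpos a2.le b2
  have d0 : w 0 - s = 0 := by
    have : p 0 * (w 0 - s) = 0 := by linarith
    simpa [a0.ne'] using this
  have d1 : w 1 - s = 0 := by
    have : p 1 * (w 1 - s) = 0 := by linarith
    simpa [a1.ne'] using this
  have d2 : w 2 - s = 0 := by
    have : p 2 * (w 2 - s) = 0 := by linarith
    simpa [a2.ne'] using this
  ext i
  fin_cases i <;> simp <;> linarith

noncomputable def bgF (p μ : Fin 3 → ℝ) : ℝ := bgJ (fun θ φ => Real.exp (bgL p μ θ φ))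

noncomputable def bgD (p v μ : Fin 3 → ℝ) : ℝ :=
  bgJ (fun θ φ => bgL p v θ φ * Real.exp (bgL p μ θ φ))

theorem bgF_cont (p : Fin 3 → ℝ) : Continuous (bgF p) :=
  bgJ_cont _ (Real.continuous_exp.comp (bgL_cont p))

theorem bgD_cont (p v : Fin 3 → ℝ) : Continuous (bgD p v) :=
  bgJ_cont _ (((bgL_cont' p v).comp continuous_snd).mul (Real.continuous_exp.comp (bgL_cont p)))

theorem bgL_smul (p w : Fin 3 → ℝ) (c θ φ : ℝ) : bgL p (c • w) θ φ = c * bgL p w θ φ := by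
  simp [bgL]; ring

theorem bgL_add (p w v : Fin 3 → ℝ) (θ φ : ℝ) :
    bgL p (w + v) θ φ = bgL p w θ φ + bgL p v θ φ := by
  simp [bgL]; ring

theorem bgF_coercive (p : Fin 3 → ℝ) (hp : ∀ i, 0 < p i) (hp1 : p 0 + p 1 + p 2 = 1) :
    ∃ c > 0, ∀ μ : Fin 3 → ℝ, μ 0 + μ 1 + μ 2 = 0 → c * ‖μ‖ ≤ bgF p μ := by
  let G : (Fin 3 → ℝ) → ℝ := fun w => bgJ (fun θ φ => max 0 (bgL p w θ φ))
  have hG : Continuous G := bgJ_cont _ (continuous_const.max (bgL_cont p))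
  have hclosed : IsClosed {w : Fin 3 → ℝ | w 0 + w 1 + w 2 = 0} :=
    isClosed_eq (by fun_prop) continuous_const
  have hK : IsCompact (Metric.sphere (0 : Fin 3 → ℝ) 1 ∩ {w | w 0 + w 1 + w 2 = 0}) :=
    (isCompact_sphere _ _).inter_right hclosed
  have hGpos : ∀ w ∈ Metric.sphere (0 : Fin 3 → ℝ) 1 ∩ {w | w 0 + w 1 + w 2 = 0}, 0 < G w := by
    rintro w ⟨hw1, hw⟩
    by_contra hle
    have hz := bgJ_zero (fun θ φ => max 0 (bgL p w θ φ)) (continuous_const.max (bgL_cont' p w))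
      (fun θ φ => le_max_left _ _) (not_lt.1 hle)
    have : w = 0 := bgL_zero p w hp hp1 hw (fun θ hθ φ hφ => by
      have := hz θ hθ φ hφ
      exact (le_max_right _ _).trans this.le)
    rw [this] at hw1
    simp at hw1
  have hex : ∃ c > 0, ∀ w ∈ Metric.sphere (0 : Fin 3 → ℝ) 1 ∩ {w | w 0 + w 1 + w 2 = 0},
      c ≤ G w := by
    rcases Set.eq_empty_or_nonempty
      (Metric.sphere (0 : Fin 3 → ℝ) 1 ∩ {w | w 0 + w 1 + w 2 = 0}) with he | hne
    · exact ⟨1, one_pos, by rw [he]; simp⟩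
    · obtain ⟨w, hw, hmin⟩ := hK.exists_isMinOn hne hG.continuousOn
      exact ⟨G w, hGpos w hw, fun v hv => hmin hv⟩
  obtain ⟨c, hc, hcG⟩ := hex
  refine ⟨c, hc, fun μ hμ => ?_⟩
  by_cases h0 : μ = 0
  · subst h0
    simp only [norm_zero, mul_zero]
    exact bgJ_nonneg _ (fun _ _ => (Real.exp_pos _).le)
  have hn : 0 < ‖μ‖ := norm_pos_iff.2 h0
  have h1 := hcG (‖μ‖⁻¹ • μ) ⟨by simp [norm_smul, hn.ne'], by
    simp only [Set.mem_ofPred_eq, Pi.smul_apply, smul_eq_mul, ← mul_add, hμ, mul_zero]⟩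
  have h2 : ‖μ‖ * G (‖μ‖⁻¹ • μ) ≤ bgF p μ := by
    rw [← bgJ_mul]
    apply bgJ_mono
    · exact continuous_const.mul (continuous_const.max (bgL_cont' p _))
    · exact Real.continuous_exp.comp (bgL_cont' p _)
    · intro θ φ
      rw [bgL_smul, mul_max_of_nonneg _ _ hn.le, mul_zero, mul_inv_cancel_left₀ hn.ne']
      exact max_le (Real.exp_pos _).le (by linarith [Real.add_one_le_exp (bgL p μ θ φ)])
  nlinarith

theorem bgF_min (p : Fin 3 → ℝ) (hp : ∀ i, 0 < p i) (hp1 : p 0 + p 1 + p 2 = 1) :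
    ∃ μ : Fin 3 → ℝ, μ 0 + μ 1 + μ 2 = 0 ∧ ∀ ν, bgF p μ ≤ bgF p ν := by
  obtain ⟨c, hc, hcF⟩ := bgF_coercive p hp hp1
  have hF0 : 0 ≤ bgF p 0 := bgJ_nonneg _ (fun _ _ => (Real.exp_pos _).le)
  have hclosed : IsClosed {w : Fin 3 → ℝ | w 0 + w 1 + w 2 = 0} :=
    isClosed_eq (by fun_prop) continuous_const
  have hK : IsCompact (Metric.closedBall (0 : Fin 3 → ℝ) (bgF p 0 / c) ∩
      {w | w 0 + w 1 + w 2 = 0}) :=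
    (isCompact_closedBall _ _).inter_right hclosed
  have h0K : (0 : Fin 3 → ℝ) ∈ Metric.closedBall (0 : Fin 3 → ℝ) (bgF p 0 / c) ∩
      {w | w 0 + w 1 + w 2 = 0} := ⟨by simp; positivity, by simp⟩
  obtain ⟨μ, hμ, hmin⟩ := hK.exists_isMinOn ⟨0, h0K⟩ (bgF_cont p).continuousOn
  have hpl : ∀ ν : Fin 3 → ℝ, ν 0 + ν 1 + ν 2 = 0 → bgF p μ ≤ bgF p ν := by
    intro ν hν
    by_cases hb : ν ∈ Metric.closedBall (0 : Fin 3 → ℝ) (bgF p 0 / c)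
    · exact hmin ⟨hb, hν⟩
    · have h1 : bgF p μ ≤ bgF p 0 := hmin h0K
      have h2 := hcF ν hν
      simp at hb
      rw [div_lt_iff₀ hc] at hb
      linarith
  refine ⟨μ, hμ.2, fun ν => ?_⟩
  have h := hpl (fun i => ν i - (ν 0 + ν 1 + ν 2) / 3) (by ring)
  have he : bgF p (fun i => ν i - (ν 0 + ν 1 + ν 2) / 3) = bgF p ν := by
    unfold bgF
    congr 1; ext θ φ
    congr 1
    have := bgM_sum θ φ
    simp only [bgL]
    linear_combination (-(ν 0 + ν 1 + ν 2) / 3) * this + ((ν 0 + ν 1 + ν 2) / 3) * hp1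
  rwa [he] at h

theorem bg_crit (p μ : Fin 3 → ℝ) (hmin : ∀ ν, bgF p μ ≤ bgF p ν) (v : Fin 3 → ℝ) :
    bgD p v μ = 0 := by
  have key : ∀ s : ℝ, 0 ≤ s * bgD p v (μ + s • v) := by
    intro s
    have h1 : bgF p (μ + s • v) - bgF p μ ≤ s * bgD p v (μ + s • v) := by
      unfold bgF bgD
      have hc (w : Fin 3 → ℝ) : Continuous (fun x : ℝ × ℝ => Real.exp (bgL p w x.1 x.2)) :=
        Real.continuous_exp.comp (bgL_cont' p w)
      rw [← bgJ_sub _ _ (hc _) (hc _), ← bgJ_mul]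
      apply bgJ_mono
      · exact (hc _).sub (hc _)
      · exact continuous_const.mul ((bgL_cont' p v).mul (hc _))
      · intro θ φ
        rw [bgL_add, bgL_smul]
        set a := bgL p μ θ φ
        set x := bgL p v θ φ
        have e1 := Real.add_one_le_exp (-(s * x))
        have e2 : Real.exp a = Real.exp (a + s * x) * Real.exp (-(s * x)) := by
          rw [← Real.exp_add]; ring_nf
        have := Real.exp_pos (a + s * x)
        rw [e2]
        nlinarith
    linarith [hmin (μ + s • v)]
  have hc : Continuous (fun s : ℝ => bgD p v (μ + s • v)) :=
    (bgD_cont p v).comp (by fun_prop)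
  have h0 : bgD p v (μ + (0:ℝ) • v) = bgD p v μ := by simp
  have ht := hc.tendsto 0
  simp only [h0] at ht
  apply le_antisymm
  · have := ht.mono_left (nhdsWithin_le_nhds (s := Set.Iio 0))
    refine le_of_tendsto this ?_
    filter_upwards [self_mem_nhdsWithin] with s hs
    have hs' : s < 0 := hs
    by_contra hcon
    nlinarith [key s, mul_pos_of_neg_of_neg hs' (neg_neg_of_pos (not_le.1 hcon))]
  · have := ht.mono_left (nhdsWithin_le_nhds (s := Set.Ioi 0))
    refine ge_of_tendsto this ?_
    filter_upwards [self_mem_nhdsWithin] with s hs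
    exact nonneg_of_mul_nonneg_right (key s) hs

theorem bg_unique (p μ ν : Fin 3 → ℝ) (hp : ∀ i, 0 < p i) (hp1 : p 0 + p 1 + p 2 = 1)
    (hμ : μ 0 + μ 1 + μ 2 = 0) (hν : ν 0 + ν 1 + ν 2 = 0)
    (h1 : ∀ v, bgD p v μ = 0) (h2 : ∀ v, bgD p v ν = 0) : μ = ν := by
  have hc (v w : Fin 3 → ℝ) :
      Continuous (fun x : ℝ × ℝ => bgL p v x.1 x.2 * Real.exp (bgL p w x.1 x.2)) :=
    (bgL_cont' p v).mul (Real.continuous_exp.comp (bgL_cont' p w))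
  have hd := bgJ_sub (fun θ φ => bgL p (μ - ν) θ φ * Real.exp (bgL p μ θ φ))
    (fun θ φ => bgL p (μ - ν) θ φ * Real.exp (bgL p ν θ φ)) (hc (μ - ν) μ) (hc (μ - ν) ν)
  have e1 := h1 (μ - ν)
  have e2 := h2 (μ - ν)
  unfold bgD at e1 e2
  rw [e1, e2, sub_zero] at hd
  have hL : ∀ θ φ, bgL p (μ - ν) θ φ = bgL p μ θ φ - bgL p ν θ φ := by
    intro θ φ; simp [bgL]; ring
  have hz := bgJ_zero (fun θ φ => bgL p (μ - ν) θ φ * Real.exp (bgL p μ θ φ) -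
    bgL p (μ - ν) θ φ * Real.exp (bgL p ν θ φ)) ((hc (μ - ν) μ).sub (hc (μ - ν) ν)) (fun θ φ => by
    rw [hL, ← mul_sub]
    rcases le_total (bgL p μ θ φ) (bgL p ν θ φ) with h | h
    · exact mul_nonneg_of_nonpos_of_nonpos (sub_nonpos.2 h) (sub_nonpos.2 (Real.exp_le_exp.2 h))
    · exact mul_nonneg (sub_nonneg.2 h) (sub_nonneg.2 (Real.exp_le_exp.2 h))) hd.le
  have : μ - ν = 0 := bgL_zero p _ hp hp1 (by simp; linarith) (fun θ hθ φ hφ => by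
    have := hz θ hθ φ hφ
    rw [← mul_sub] at this
    rcases mul_eq_zero.1 this with h | h
    · exact h.le
    · rw [hL]
      have := Real.exp_injective (sub_eq_zero.1 h)
      rw [this]; simp)
  exact sub_eq_zero.1 this

theorem bg_link (p μ : Fin 3 → ℝ) (i : Fin 3) :
    binghamZ2 μ i = p i ↔ bgD p (Pi.single i 1) μ = 0 := by
  set E : ℝ → ℝ → ℝ := fun θ φ => Real.exp (∑ j, μ j * (bgM θ φ j) ^ 2) with hE
  have hEc : Continuous (fun x : ℝ × ℝ => E x.1 x.2) := by
    have := bgM_cont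
    exact Real.continuous_exp.comp (continuous_finsetSum _ fun j _ =>
      continuous_const.mul ((this j).pow 2))
  have hEn : ∀ θ φ, 0 ≤ E θ φ := fun _ _ => (Real.exp_pos _).le
  have hJE : 0 < bgJ E := by
    by_contra h
    have := bgJ_zero E hEc hEn (not_lt.1 h) 0 ⟨le_rfl, Real.pi_pos.le⟩ 0 ⟨le_rfl, by positivity⟩
    exact (Real.exp_pos _).ne' this
  have hZ : 4 * Real.pi * binghamZ μ = bgJ E := by
    have : binghamZ μ = (1 / (4 * Real.pi)) * bgJ E := rfl
    rw [this]
    field_simp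
  have hZ2 : binghamZ2 μ i = (1 / bgJ E) * bgJ (fun θ φ => (bgM θ φ i)^2 * E θ φ) := by
    rw [← hZ]; rfl
  have hD : bgD p (Pi.single i 1) μ = Real.exp (-(μ 0 * p 0 + μ 1 * p 1 + μ 2 * p 2)) *
      (bgJ (fun θ φ => (bgM θ φ i)^2 * E θ φ) - p i * bgJ E) := by
    rw [← bgJ_mul (p i), ← bgJ_sub, ← bgJ_mul]
    · unfold bgD
      congr 1; ext θ φ
      have ha : bgL p (Pi.single i 1) θ φ = (bgM θ φ i)^2 - p i := by
        fin_cases i <;> simp [bgL]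
      have hb : Real.exp (bgL p μ θ φ) =
          Real.exp (-(μ 0 * p 0 + μ 1 * p 1 + μ 2 * p 2)) * E θ φ := by
        rw [hE]
        simp only [← Real.exp_add, Fin.sum_univ_three, bgL]
        ring_nf
      rw [ha, hb]; ring
    · exact ((bgM_cont i).pow 2).mul hEc
    · exact continuous_const.mul hEc
  rw [hD, hZ2, mul_eq_zero, or_iff_right (Real.exp_pos _).ne', sub_eq_zero, one_div,
    inv_mul_eq_iff_eq_mul₀ hJE.ne', mul_comm]

theorem bgD_all (p μ : Fin 3 → ℝ) (h : ∀ i, bgD p (Pi.single i 1) μ = 0) (v : Fin 3 → ℝ) :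
    bgD p v μ = 0 := by
  have hc (v w : Fin 3 → ℝ) :
      Continuous (fun x : ℝ × ℝ => bgL p v x.1 x.2 * Real.exp (bgL p w x.1 x.2)) :=
    (bgL_cont' p v).mul (Real.continuous_exp.comp (bgL_cont' p w))
  have hsub : ∀ v w, bgD p (v - w) μ = bgD p v μ - bgD p w μ := by
    intro v w
    unfold bgD
    rw [← bgJ_sub _ _ (hc _ _) (hc _ _)]
    congr 1; ext θ φ; simp [bgL]; ring
  have hsm : ∀ (c : ℝ) v, bgD p (c • v) μ = c * bgD p v μ := by
    intro c v
    unfold bgD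
    rw [← bgJ_mul]
    congr 1; ext θ φ; rw [bgL_smul]; ring
  have hv : v = v 0 • Pi.single 0 1 - (-v 1) • Pi.single 1 1 - (-v 2) • Pi.single 2 1 := by
    ext i; fin_cases i <;> simp
  rw [hv, hsub, hsub, hsm, hsm, hsm, h, h, h]; ring

/-- Existence and uniqueness of the three-dimensional Bingham closure: for every
`q` in `Δ₀ = {q : q₁+q₂+q₃ = 0, qᵢ ∈ (−1/3, 2/3)}` there is a unique traceless
`μ ∈ ℝ³` with `zᵢ(μ) = qᵢ + 1/3` for all `i`. -/
theorem bingham_closure_3d_exists_unique (q : Fin 3 → ℝ)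
    (hsum : q 0 + q 1 + q 2 = 0)
    (hmem : ∀ i, q i ∈ Set.Ioo (-(1/3) : ℝ) (2/3)) :
    ∃! μ : Fin 3 → ℝ, μ 0 + μ 1 + μ 2 = 0 ∧ ∀ i, binghamZ2 μ i = q i + 1/3 := by
  have hp : ∀ i, 0 < q i + 1/3 := fun i => by linarith [(hmem i).1]
  have hp1 : (q 0 + 1/3) + (q 1 + 1/3) + (q 2 + 1/3) = 1 := by linarith
  obtain ⟨μ, hμ, hmin⟩ := bgF_min (fun i => q i + 1/3) hp hp1
  have hcr := bg_crit (fun i => q i + 1/3) μ hmin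
  refine ⟨μ, ⟨hμ, fun i => (bg_link (fun i => q i + 1/3) μ i).2 (hcr _)⟩, ?_⟩
  rintro ν ⟨hν, hν2⟩
  exact bg_unique (fun i => q i + 1/3) ν μ hp hp1 hν hμ
    (bgD_all _ _ (fun i => (bg_link (fun i => q i + 1/3) ν i).1 (hν2 i))) hcr
end

section
/- There exist M > 0 and constants C₁, C₂ > 0 such that for all x ≥ M and all y ≥ 0, with μ = (0, −2x, −2y), one has 1/(2x + C₁ √x) ≤ 2 z₂(μ) ≤ C₂ / x. In particular, z₂(0, −2x, −2y) decays at the exact rate x^{−1} as x → ∞, uniformly in y ≥ 0. -/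
open Real Filter

noncomputable def bw (x y θ φ : ℝ) : ℝ :=
  Real.exp (-2 * x * (Real.sin θ * Real.sin φ) ^ 2 + -2 * y * Real.cos θ ^ 2)

lemma bw_pos (x y θ φ : ℝ) : 0 < bw x y θ φ := Real.exp_pos _

lemma swap_cont (F : ℝ → ℝ → ℝ) (hF : Continuous (Function.uncurry F)) (a b c d : ℝ) :
    ∫ s in a..b, ∫ t in c..d, F s t = ∫ t in c..d, ∫ s in a..b, F s t := by
  apply MeasureTheory.intervalIntegral_intervalIntegral_swap
  have h : MeasureTheory.IntegrableOn (Function.uncurry F) (Set.uIcc a b ×ˢ Set.uIcc c d)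
      MeasureTheory.volume :=
    hF.continuousOn.integrableOn_compact (isCompact_uIcc.prod isCompact_uIcc)
  exact h.mono_set (Set.prod_mono Set.uIoc_subset_uIcc Set.uIoc_subset_uIcc)

lemma phi_deriv (x y θ φ : ℝ) :
    HasDerivAt (fun φ => Real.sin φ * Real.cos φ * bw x y θ φ)
      ((Real.cos φ ^ 2 - Real.sin φ ^ 2
        - 4 * x * Real.sin θ ^ 2 * Real.sin φ ^ 2 * Real.cos φ ^ 2) * bw x y θ φ) φ := by
  have h1 : HasDerivAt (fun φ => -2 * x * (Real.sin θ * Real.sin φ) ^ 2 + -2 * y * Real.cos θ ^ 2)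
      (-2 * x * (2 * (Real.sin θ * Real.sin φ) * (Real.sin θ * Real.cos φ))) φ := by
    have := ((((Real.hasDerivAt_sin φ).const_mul (Real.sin θ)).pow 2).const_mul (-2 * x)).add_const
      (-2 * y * Real.cos θ ^ 2)
    convert! this using 1
    push_cast; ring
  have h2 := ((Real.hasDerivAt_sin φ).mul (Real.hasDerivAt_cos φ)).mul h1.exp
  convert! h2 using 1
  simp only [bw, Pi.mul_apply]; ring

lemma theta_deriv (x y θ φ : ℝ) :
    HasDerivAt (fun θ => Real.sin φ ^ 2 * (Real.sin θ ^ 2 * Real.cos θ) * bw x y θ φ)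
      (Real.sin φ ^ 2 * (2 * Real.cos θ ^ 2 - Real.sin θ ^ 2
        - 4 * x * Real.sin θ ^ 2 * Real.cos θ ^ 2 * Real.sin φ ^ 2
        + 4 * y * Real.sin θ ^ 2 * Real.cos θ ^ 2) * bw x y θ φ * Real.sin θ) θ := by
  have h1 : HasDerivAt (fun θ => -2 * x * (Real.sin θ * Real.sin φ) ^ 2 + -2 * y * Real.cos θ ^ 2)
      (-2 * x * (2 * (Real.sin θ * Real.sin φ) * (Real.cos θ * Real.sin φ))
        + -2 * y * (2 * Real.cos θ * (- Real.sin θ))) θ := by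
    have := ((((Real.hasDerivAt_sin θ).mul_const (Real.sin φ)).pow 2).const_mul (-2 * x)).add
      (((Real.hasDerivAt_cos θ).pow 2).const_mul (-2 * y))
    convert! this using 1
    push_cast; ring
  have h2 := ((((Real.hasDerivAt_sin θ).pow 2).mul (Real.hasDerivAt_cos θ)).const_mul
    (Real.sin φ ^ 2)).mul h1.exp
  convert! h2 using 1
  simp only [bw, Pi.mul_apply, Pi.pow_apply]; push_cast; ring

lemma phi_int (x y θ : ℝ) :
    ∫ φ in (0:ℝ)..(2 * Real.pi), (Real.cos φ ^ 2 - Real.sin φ ^ 2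
        - 4 * x * Real.sin θ ^ 2 * Real.sin φ ^ 2 * Real.cos φ ^ 2) * bw x y θ φ = 0 := by
  rw [intervalIntegral.integral_eq_sub_of_hasDerivAt (fun φ _ => phi_deriv x y θ φ)]
  · simp
  · apply Continuous.intervalIntegrable
    unfold bw; fun_prop

lemma theta_int (x y φ : ℝ) :
    ∫ θ in (0:ℝ)..Real.pi, (Real.sin φ ^ 2 * (2 * Real.cos θ ^ 2 - Real.sin θ ^ 2
        - 4 * x * Real.sin θ ^ 2 * Real.cos θ ^ 2 * Real.sin φ ^ 2
        + 4 * y * Real.sin θ ^ 2 * Real.cos θ ^ 2) * bw x y θ φ * Real.sin θ) = 0 := by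
  rw [intervalIntegral.integral_eq_sub_of_hasDerivAt (fun θ _ => theta_deriv x y θ φ)]
  · simp
  · apply Continuous.intervalIntegrable
    unfold bw; fun_prop

/-- double integral helper -/
noncomputable def dI (F : ℝ → ℝ → ℝ) : ℝ :=
  ∫ θ in (0:ℝ)..Real.pi, ∫ φ in (0:ℝ)..(2 * Real.pi), F θ φ

lemma inner_ii (F : ℝ → ℝ → ℝ) (hF : Continuous (Function.uncurry F)) (θ a b : ℝ) :
    IntervalIntegrable (F θ) MeasureTheory.volume a b :=
  (hF.comp (Continuous.prodMk_right θ)).intervalIntegrable _ _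

lemma outer_ii (F : ℝ → ℝ → ℝ) (hF : Continuous (Function.uncurry F)) (a b c d : ℝ) :
    IntervalIntegrable (fun θ => ∫ φ in c..d, F θ φ) MeasureTheory.volume a b :=
  (intervalIntegral.continuous_parametric_intervalIntegral_of_continuous' hF c d).intervalIntegrable
    _ _

lemma dI_add (F G : ℝ → ℝ → ℝ) (hF : Continuous (Function.uncurry F))
    (hG : Continuous (Function.uncurry G)) :
    dI (fun θ φ => F θ φ + G θ φ) = dI F + dI G := by
  unfold dI
  rw [← intervalIntegral.integral_add (outer_ii F hF _ _ _ _) (outer_ii G hG _ _ _ _)]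
  refine intervalIntegral.integral_congr fun θ _ => ?_
  exact intervalIntegral.integral_add (inner_ii F hF _ _ _) (inner_ii G hG _ _ _)

lemma dI_smul (c : ℝ) (F : ℝ → ℝ → ℝ) : dI (fun θ φ => c * F θ φ) = c * dI F := by
  unfold dI
  simp only [intervalIntegral.integral_const_mul]

lemma dI_mono (F G : ℝ → ℝ → ℝ) (hF : Continuous (Function.uncurry F))
    (hG : Continuous (Function.uncurry G))
    (h : ∀ θ ∈ Set.Icc 0 Real.pi, ∀ φ, F θ φ ≤ G θ φ) : dI F ≤ dI G := by
  unfold dI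
  refine intervalIntegral.integral_mono_on Real.pi_pos.le (outer_ii F hF _ _ _ _)
    (outer_ii G hG _ _ _ _) fun θ hθ => ?_
  exact intervalIntegral.integral_mono_on (by positivity) (inner_ii F hF _ _ _) (inner_ii G hG _ _ _)
    fun φ _ => h θ hθ φ

noncomputable def bN (x y : ℝ) : ℝ :=
  dI (fun θ φ => (Real.sin θ * Real.sin φ) ^ 2 * bw x y θ φ * Real.sin θ)

noncomputable def bD (x y : ℝ) : ℝ := dI (fun θ φ => bw x y θ φ * Real.sin θ)

lemma bD_pos (x y : ℝ) : 0 < bD x y := by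
  unfold bD dI
  have hc : Continuous (Function.uncurry fun θ φ => bw x y θ φ * Real.sin θ) := by
    unfold bw Function.uncurry; fun_prop
  refine intervalIntegral.intervalIntegral_pos_of_pos_on (outer_ii _ hc _ _ _ _) (fun θ hθ => ?_)
    Real.pi_pos
  exact intervalIntegral.intervalIntegral_pos_of_pos_on (inner_ii _ hc _ _ _)
    (fun φ _ => mul_pos (bw_pos _ _ _ _) (Real.sin_pos_of_mem_Ioo hθ)) (by positivity)

lemma z2_eq (x y : ℝ) : binghamZ2 ![0, -2 * x, -2 * y] 1 = bN x y / bD x y := by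
  have h1 : sphereIntegral (fun m => Real.exp (∑ i, (![0, -2 * x, -2 * y] : Fin 3 → ℝ) i * (m i) ^ 2))
      = bD x y := by
    simp [sphereIntegral, bD, dI, bw, Fin.sum_univ_three]
  have h2 : sphereIntegral (fun m => (m 1) ^ 2 *
      Real.exp (∑ i, (![0, -2 * x, -2 * y] : Fin 3 → ℝ) i * (m i) ^ 2)) = bN x y := by
    simp [sphereIntegral, bN, dI, bw, Fin.sum_univ_three]
  unfold binghamZ2 binghamZ
  rw [h1, h2]
  have := (bD_pos x y).ne'
  have := Real.pi_ne_zero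
  field_simp

lemma lower_key (x y : ℝ) (hx : 0 ≤ x) (hy : 0 ≤ y) : bD x y ≤ (4 * x + 3) * bN x y := by
  set A : ℝ → ℝ → ℝ := fun θ φ => (Real.cos φ ^ 2 - Real.sin φ ^ 2
        - 4 * x * Real.sin θ ^ 2 * Real.sin φ ^ 2 * Real.cos φ ^ 2) * bw x y θ φ * Real.sin θ with hA
  set B : ℝ → ℝ → ℝ := fun θ φ => (Real.sin φ ^ 2 * (2 * Real.cos θ ^ 2 - Real.sin θ ^ 2
        - 4 * x * Real.sin θ ^ 2 * Real.cos θ ^ 2 * Real.sin φ ^ 2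
        + 4 * y * Real.sin θ ^ 2 * Real.cos θ ^ 2) * bw x y θ φ * Real.sin θ) with hB
  have cA : Continuous (Function.uncurry A) := by
    simp only [hA]; unfold bw Function.uncurry; fun_prop
  have cB : Continuous (Function.uncurry B) := by
    simp only [hB]; unfold bw Function.uncurry; fun_prop
  have iA : dI A = 0 := by
    unfold dI
    simp only [hA, intervalIntegral.integral_mul_const, phi_int]
    simp
  have iB : dI B = 0 := by
    unfold dI
    rw [swap_cont B cB]
    simp only [hB, theta_int]
    simp
  set N : ℝ → ℝ → ℝ := fun θ φ => (Real.sin θ * Real.sin φ) ^ 2 * bw x y θ φ * Real.sin θ with hN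
  have cN : Continuous (Function.uncurry N) := by
    simp only [hN]; unfold bw Function.uncurry; fun_prop
  have cN' : Continuous (Function.uncurry (fun θ φ => (4 * x + 3) * N θ φ)) := by
    simp only [hN]; unfold bw Function.uncurry; fun_prop
  have cAB : Continuous (Function.uncurry (fun θ φ => A θ φ + B θ φ)) := cA.add cB
  have key : bD x y ≤ dI (fun θ φ => (A θ φ + B θ φ) + (4 * x + 3) * N θ φ) := by
    unfold bD
    apply dI_mono
    · unfold bw Function.uncurry; fun_prop
    · exact cAB.add cN'
    · intro θ hθ φ
      have hs := Real.sin_nonneg_of_mem_Icc hθ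
      have hw := (bw_pos x y θ φ).le
      have e : (A θ φ + B θ φ) + (4 * x + 3) * N θ φ - bw x y θ φ * Real.sin θ
          = (4 * x * (Real.sin θ * Real.sin φ) ^ 4
            + 4 * y * (Real.sin θ * Real.sin φ) ^ 2 * Real.cos θ ^ 2) * (bw x y θ φ * Real.sin θ) := by
        simp only [hA, hB, hN]
        have e1 : Real.cos φ ^ 2 = 1 - Real.sin φ ^ 2 := by linarith [Real.sin_sq_add_cos_sq φ]
        have e2 : Real.cos θ ^ 2 = 1 - Real.sin θ ^ 2 := by linarith [Real.sin_sq_add_cos_sq θ]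
        rw [e1, e2]; ring
      have : 0 ≤ (4 * x * (Real.sin θ * Real.sin φ) ^ 4
            + 4 * y * (Real.sin θ * Real.sin φ) ^ 2 * Real.cos θ ^ 2) * (bw x y θ φ * Real.sin θ) := by
        positivity
      linarith
  rw [dI_add _ _ cAB cN', dI_add A B cA cB, iA, iB, dI_smul] at key
  simpa [bN] using key

lemma phi_upper (b : ℝ) (hb : 0 ≤ b) :
    b * ∫ φ in (0:ℝ)..(2 * Real.pi), Real.sin φ ^ 2 * Real.exp (-b * Real.sin φ ^ 2)
      ≤ 2 * ∫ φ in (0:ℝ)..(2 * Real.pi), Real.exp (-b * Real.sin φ ^ 2) := by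
  have hshift : ∫ φ in (0:ℝ)..(2 * Real.pi), Real.exp (-b * Real.cos φ ^ 2)
      = ∫ φ in (0:ℝ)..(2 * Real.pi), Real.exp (-b * Real.sin φ ^ 2) := by
    have hp : Function.Periodic (fun φ => Real.exp (-b * Real.sin φ ^ 2)) (2 * Real.pi) := by
      intro φ; simp
    have h1 := hp.intervalIntegral_add_eq 0 (Real.pi / 2)
    rw [zero_add] at h1
    rw [h1, add_comm (Real.pi / 2)]
    have h2 := intervalIntegral.integral_comp_add_right (a := 0) (b := 2 * Real.pi)
      (fun φ => Real.exp (-b * Real.sin φ ^ 2)) (Real.pi / 2)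
    rw [zero_add] at h2
    rw [← h2]
    simp only [Real.sin_add_pi_div_two]
  have hibp : ∫ φ in (0:ℝ)..(2 * Real.pi), (Real.cos φ ^ 2 - Real.sin φ ^ 2
        - 2 * b * Real.sin φ ^ 2 * Real.cos φ ^ 2) * Real.exp (-b * Real.sin φ ^ 2) = 0 := by
    have := phi_int (b / 2) 0 (Real.pi / 2)
    simp only [bw, Real.sin_pi_div_two, Real.cos_pi_div_two] at this
    refine Eq.trans ?_ this
    refine intervalIntegral.integral_congr fun φ _ => ?_
    ring_nf
  have hmono : ∫ φ in (0:ℝ)..(2 * Real.pi), b * (Real.sin φ ^ 2 * Real.exp (-b * Real.sin φ ^ 2))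
      ≤ ∫ φ in (0:ℝ)..(2 * Real.pi), ((Real.exp (-b * Real.cos φ ^ 2)
        + Real.exp (-b * Real.sin φ ^ 2)) - (Real.cos φ ^ 2 - Real.sin φ ^ 2
        - 2 * b * Real.sin φ ^ 2 * Real.cos φ ^ 2) * Real.exp (-b * Real.sin φ ^ 2)) := by
    refine intervalIntegral.integral_mono_on (by positivity)
      (Continuous.intervalIntegrable (by fun_prop) _ _)
      (Continuous.intervalIntegrable (by fun_prop) _ _) fun φ _ => ?_
    have e1 : Real.cos φ ^ 2 = 1 - Real.sin φ ^ 2 := by linarith [Real.sin_sq_add_cos_sq φ]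
    have hs0 : 0 ≤ Real.sin φ ^ 2 := sq_nonneg _
    have hs1 : Real.sin φ ^ 2 ≤ 1 := by linarith [sq_nonneg (Real.cos φ)]
    rw [e1]
    generalize Real.sin φ ^ 2 = s at *
    have hexp : Real.exp (-b * (1 - s)) = Real.exp (-b * s) * Real.exp (b * (2 * s - 1)) := by
      rw [← Real.exp_add]; ring_nf
    have h3 := Real.add_one_le_exp (b * (2 * s - 1))
    have h4 : 0 < Real.exp (b * (2 * s - 1)) := Real.exp_pos _
    have h5 : s * (b * (2 * s - 1)) ≤ Real.exp (b * (2 * s - 1)) := by nlinarith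
    have h6 : 0 < Real.exp (-b * s) := Real.exp_pos _
    rw [hexp]
    nlinarith [mul_le_mul_of_nonneg_left h5 h6.le, mul_nonneg h6.le hs0]
  rw [intervalIntegral.integral_sub, intervalIntegral.integral_add, hibp, hshift,
    intervalIntegral.integral_const_mul] at hmono
  · linarith
  all_goals exact Continuous.intervalIntegrable (by fun_prop) _ _

lemma upper_key (x y : ℝ) (hx : 0 ≤ x) : x * bN x y ≤ bD x y := by
  have cD : Continuous (Function.uncurry fun θ φ => bw x y θ φ * Real.sin θ) := by
    unfold bw Function.uncurry; fun_prop
  have cN : Continuous (Function.uncurry fun θ φ =>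
      x * ((Real.sin θ * Real.sin φ) ^ 2 * bw x y θ φ * Real.sin θ)) := by
    unfold bw Function.uncurry; fun_prop
  unfold bN bD
  rw [← dI_smul]
  unfold dI
  refine intervalIntegral.integral_mono_on Real.pi_pos.le (outer_ii _ cN _ _ _ _)
    (outer_ii _ cD _ _ _ _) fun θ hθ => ?_
  have hs := Real.sin_nonneg_of_mem_Icc hθ
  have h := phi_upper (2 * x * Real.sin θ ^ 2) (by positivity)
  have hw : ∀ φ, bw x y θ φ = Real.exp (-(2 * x * Real.sin θ ^ 2) * Real.sin φ ^ 2)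
      * Real.exp (-2 * y * Real.cos θ ^ 2) := by
    intro φ; unfold bw; rw [← Real.exp_add]; ring_nf
  have e1 : ∫ φ in (0:ℝ)..(2 * Real.pi), x * ((Real.sin θ * Real.sin φ) ^ 2 * bw x y θ φ * Real.sin θ)
      = (x * Real.sin θ ^ 2 * Real.exp (-2 * y * Real.cos θ ^ 2) * Real.sin θ) *
        ∫ φ in (0:ℝ)..(2 * Real.pi),
          Real.sin φ ^ 2 * Real.exp (-(2 * x * Real.sin θ ^ 2) * Real.sin φ ^ 2) := by
    rw [← intervalIntegral.integral_const_mul]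
    refine intervalIntegral.integral_congr fun φ _ => ?_
    simp only [hw]; ring
  have e2 : ∫ φ in (0:ℝ)..(2 * Real.pi), bw x y θ φ * Real.sin θ
      = (Real.exp (-2 * y * Real.cos θ ^ 2) * Real.sin θ) *
        ∫ φ in (0:ℝ)..(2 * Real.pi), Real.exp (-(2 * x * Real.sin θ ^ 2) * Real.sin φ ^ 2) := by
    rw [← intervalIntegral.integral_const_mul]
    refine intervalIntegral.integral_congr fun φ _ => ?_
    simp only [hw]; ring
  rw [e1, e2]
  have hc : 0 ≤ Real.exp (-2 * y * Real.cos θ ^ 2) * Real.sin θ := by positivity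
  have := mul_le_mul_of_nonneg_left h hc
  linarith

/-- Two-sided decay estimate for `z₂`: there exist `M > 0` and constants
`C₁, C₂ > 0` such that for all `x ≥ M`, `y ≥ 0`, with `μ = (0, −2x, −2y)`,
`1/(2x + C₁ √x) ≤ 2 z₂(μ) ≤ C₂ / x`. -/
theorem binghamZ2_two_sided_decay :
    ∃ M : ℝ, 0 < M ∧ ∃ C₁ : ℝ, 0 < C₁ ∧ ∃ C₂ : ℝ, 0 < C₂ ∧
      ∀ x : ℝ, M ≤ x → ∀ y : ℝ, 0 ≤ y →
        1 / (2 * x + C₁ * Real.sqrt x) ≤ 2 * binghamZ2 ![0, -2 * x, -2 * y] 1 ∧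
        2 * binghamZ2 ![0, -2 * x, -2 * y] 1 ≤ C₂ / x := by
  refine ⟨1, one_pos, 2, two_pos, 2, two_pos, fun x hx y hy => ?_⟩
  have hx0 : 0 < x := by linarith
  have hD := bD_pos x y
  have hl := lower_key x y hx0.le hy
  have hu := upper_key x y hx0.le
  have hsq : 1 ≤ Real.sqrt x := Real.one_le_sqrt.mpr hx
  rw [z2_eq]
  constructor
  · have hN : 0 ≤ bN x y := by
      by_contra hneg
      push Not at hneg
      nlinarith
    rw [← mul_div_assoc, div_le_div_iff₀ (by positivity) hD]
    nlinarith
  · rw [← mul_div_assoc, div_le_div_iff₀ hD hx0]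
    linarith
end

section
/- There exists a constant C > 0 such that for all μ ∈ ℝ³ and all indices i, j ∈ {1,2,3}, |(μᵢ + 1/(2 zᵢ(μ))) − (μⱼ + 1/(2 zⱼ(μ)))| ≤ C. (This quantity is a component difference of the gradient of the correction term ΔS = S − Ŝ in the three-dimensional entropy decomposition, expressed explicitly in the variable μ; its uniform boundedness is the content of Proposition 3.2.) -/
open Real Filter

/-- Parametrization of the sphere. -/
noncomputable def sph (θ φ : ℝ) : Fin 3 → ℝ :=
  ![Real.sin θ * Real.cos φ, Real.sin θ * Real.sin φ, Real.cos θ]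

/-- Infinitesimal rotation. -/
noncomputable def rotv (k l : Fin 3) (m : Fin 3 → ℝ) : Fin 3 → ℝ :=
  Pi.single l (m k) - Pi.single k (m l)

lemma sph_cont : Continuous (fun x : ℝ × ℝ => sph x.1 x.2) := by
  unfold sph
  refine continuous_pi fun i => ?_
  fin_cases i <;> simp <;> fun_prop

lemma rotv_cont (k l : Fin 3) : Continuous (rotv k l) := by
  unfold rotv
  refine continuous_pi fun i => ?_
  simp only [Pi.sub_apply, Pi.single_apply]
  refine Continuous.sub ?_ ?_
  · split_ifs <;> fun_prop
  · split_ifs <;> fun_prop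

lemma sphI_eq (f : (Fin 3 → ℝ) → ℝ) : sphereIntegral f =
    ∫ θ in (0:ℝ)..Real.pi, ∫ φ in (0:ℝ)..(2 * Real.pi), f (sph θ φ) * Real.sin θ := rfl

/-- Derivative in the azimuth. -/
noncomputable def vPh (θ φ : ℝ) : Fin 3 → ℝ := ![-(Real.sin θ * Real.sin φ), Real.sin θ * Real.cos φ, 0]

/-- Derivative in the polar angle. -/
noncomputable def vTh (θ φ : ℝ) : Fin 3 → ℝ := ![Real.cos θ * Real.cos φ, Real.cos θ * Real.sin φ, -Real.sin θ]

lemma vPh_cont : Continuous (fun x : ℝ × ℝ => vPh x.1 x.2) := by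
  unfold vPh
  refine continuous_pi fun i => ?_
  fin_cases i <;> simp <;> fun_prop

lemma vTh_cont : Continuous (fun x : ℝ × ℝ => vTh x.1 x.2) := by
  unfold vTh
  refine continuous_pi fun i => ?_
  fin_cases i <;> simp <;> fun_prop

lemma sph_dφ (θ φ : ℝ) : HasDerivAt (fun y => sph θ y)
    (vPh θ φ) φ := by
  rw [hasDerivAt_pi]
  intro i
  fin_cases i
  · simpa [sph, vPh, vTh] using (Real.hasDerivAt_cos φ).const_mul (Real.sin θ)
  · simpa [sph, vPh, vTh] using (Real.hasDerivAt_sin φ).const_mul (Real.sin θ)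
  · simpa [sph, vPh, vTh] using hasDerivAt_const φ (Real.cos θ)

lemma sph_dθ (θ φ : ℝ) : HasDerivAt (fun x => sph x φ)
    (vTh θ φ) θ := by
  rw [hasDerivAt_pi]
  intro i
  fin_cases i
  · simpa [sph, vPh, vTh] using (Real.hasDerivAt_sin θ).mul_const (Real.cos φ)
  · simpa [sph, vPh, vTh] using (Real.hasDerivAt_sin θ).mul_const (Real.sin φ)
  · simpa [sph, vPh, vTh] using (Real.hasDerivAt_cos θ)

lemma inner_cont {g : ℝ → ℝ → ℝ} (hg : Continuous (fun x : ℝ × ℝ => g x.1 x.2)) (a b : ℝ) :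
    Continuous (fun θ => ∫ φ in a..b, g θ φ) :=
  intervalIntegral.continuous_parametric_intervalIntegral_of_continuous' (f := g) hg a b

lemma sphI_integrand {f : (Fin 3 → ℝ) → ℝ} (hf : Continuous f) :
    Continuous (fun x : ℝ × ℝ => f (sph x.1 x.2) * Real.sin x.1) :=
  (hf.comp sph_cont).mul (Real.continuous_sin.comp continuous_fst)

lemma slice {g : ℝ → ℝ → ℝ} (hg : Continuous (fun x : ℝ × ℝ => g x.1 x.2)) (θ : ℝ) :
    Continuous (fun φ => g θ φ) := hg.comp (by fun_prop : Continuous fun φ : ℝ => (θ, φ))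

lemma slice' {g : ℝ → ℝ → Fin 3 → ℝ} (hg : Continuous (fun x : ℝ × ℝ => g x.1 x.2)) (θ : ℝ) :
    Continuous (fun φ => g θ φ) := hg.comp (by fun_prop : Continuous fun φ : ℝ => (θ, φ))

lemma slice2' {g : ℝ → ℝ → Fin 3 → ℝ} (hg : Continuous (fun x : ℝ × ℝ => g x.1 x.2)) (φ : ℝ) :
    Continuous (fun θ => g θ φ) := hg.comp (by fun_prop : Continuous fun θ : ℝ => (θ, φ))

lemma sphI_add {f g : (Fin 3 → ℝ) → ℝ} (hf : Continuous f) (hg : Continuous g) :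
    sphereIntegral (fun m => f m + g m) = sphereIntegral f + sphereIntegral g := by
  have h1 := sphI_integrand hf
  have h2 := sphI_integrand hg
  simp only [sphI_eq]
  rw [← intervalIntegral.integral_add ((inner_cont (g := fun θ φ => f (sph θ φ) * Real.sin θ) h1 _ _).intervalIntegrable _ _)
    ((inner_cont (g := fun θ φ => g (sph θ φ) * Real.sin θ) h2 _ _).intervalIntegrable _ _)]
  congr 1; ext θ
  rw [← intervalIntegral.integral_add ((slice (g := fun θ φ => f (sph θ φ) * Real.sin θ) h1 θ).intervalIntegrable _ _)
    ((slice (g := fun θ φ => g (sph θ φ) * Real.sin θ) h2 θ).intervalIntegrable _ _)]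
  congr 1; ext φ; ring

lemma sphI_smul (c : ℝ) (f : (Fin 3 → ℝ) → ℝ) :
    sphereIntegral (fun m => c * f m) = c * sphereIntegral f := by
  simp only [sphI_eq, mul_assoc, intervalIntegral.integral_const_mul]

lemma sphI_nonneg {f : (Fin 3 → ℝ) → ℝ} (hf : ∀ m, 0 ≤ f m) : 0 ≤ sphereIntegral f := by
  rw [sphI_eq]
  refine intervalIntegral.integral_nonneg Real.pi_pos.le fun θ hθ => ?_
  refine intervalIntegral.integral_nonneg (by positivity) fun φ _ => ?_
  exact mul_nonneg (hf _) (Real.sin_nonneg_of_mem_Icc hθ)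

lemma sphI_pos {f : (Fin 3 → ℝ) → ℝ} (hc : Continuous f) (hf : ∀ m, 0 < f m) :
    0 < sphereIntegral f := by
  rw [sphI_eq]
  have h1 := sphI_integrand hc
  refine intervalIntegral.intervalIntegral_pos_of_pos_on
    ((inner_cont (g := fun θ φ => f (sph θ φ) * Real.sin θ) h1 _ _).intervalIntegrable _ _)
    (fun θ hθ => ?_) Real.pi_pos
  refine intervalIntegral.intervalIntegral_pos_of_pos_on
    ((slice (g := fun θ φ => f (sph θ φ) * Real.sin θ) h1 θ).intervalIntegrable _ _)
    (fun φ _ => ?_) (by positivity)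
  exact mul_pos (hf _) (Real.sin_pos_of_mem_Ioo hθ)

lemma sphI_congr {f g : (Fin 3 → ℝ) → ℝ} (h : ∀ m, m 0 ^ 2 + m 1 ^ 2 + m 2 ^ 2 = 1 → f m = g m) :
    sphereIntegral f = sphereIntegral g := by
  simp only [sphI_eq]
  congr 1; ext θ; congr 1; ext φ
  rw [h]
  simp [sph]
  nlinarith [Real.sin_sq_add_cos_sq θ, Real.sin_sq_add_cos_sq φ]

section IBP
variable {G : (Fin 3 → ℝ) → ℝ}

lemma fd_cont (hG : ContDiff ℝ 1 G) {v : ℝ × ℝ → Fin 3 → ℝ} (hv : Continuous v) :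
    Continuous (fun x : ℝ × ℝ => fderiv ℝ G (sph x.1 x.2) (v x)) :=
  ((hG.continuous_fderiv one_ne_zero).comp sph_cont).clm_apply hv

lemma curve_int (hG : ContDiff ℝ 1 G) {a a' : ℝ → ℝ} (ha : ∀ t, HasDerivAt a (a' t) t)
    (hc : Continuous a') {c v : ℝ → Fin 3 → ℝ} (hs : Continuous c)
    (hcd : ∀ t, HasDerivAt c (v t) t) (hv : Continuous v) {x y : ℝ}
    (hend : a y * G (c y) = a x * G (c x)) :
    ∫ t in x..y, (a' t * G (c t) + a t * fderiv ℝ G (c t) (v t)) = 0 := by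
  have hd : Differentiable ℝ G := hG.differentiable one_ne_zero
  have hac : Continuous a := continuous_iff_continuousAt.2 fun x => (ha x).continuousAt
  have hder : ∀ t ∈ Set.uIcc x y, HasDerivAt (fun t => a t * G (c t))
      (a' t * G (c t) + a t * fderiv ℝ G (c t) (v t)) t := fun t _ =>
    (ha t).mul ((hd (c t)).hasFDerivAt.comp_hasDerivAt t (hcd t))
  have hi : Continuous fun t => a' t * G (c t) + a t * fderiv ℝ G (c t) (v t) :=
    (hc.mul (hG.continuous.comp hs)).add
      (hac.mul (((hG.continuous_fderiv one_ne_zero).comp hs).clm_apply hv))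
  rw [intervalIntegral.integral_eq_sub_of_hasDerivAt hder (hi.intervalIntegrable _ _)]
  exact sub_eq_zero.2 hend

lemma dφ_int (hG : ContDiff ℝ 1 G) {a : ℝ → ℝ} {a' : ℝ → ℝ} (ha : ∀ φ, HasDerivAt a (a' φ) φ)
    (hc : Continuous a') (hper : a (2 * Real.pi) = a 0) (θ : ℝ) :
    ∫ φ in (0:ℝ)..(2 * Real.pi), (a' φ * G (sph θ φ) + a φ * fderiv ℝ G (sph θ φ)
      (vPh θ φ)) = 0 := by
  have hend : sph θ (2 * Real.pi) = sph θ 0 := by simp [sph]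
  exact curve_int hG ha hc (c := fun φ => sph θ φ) (v := fun φ => vPh θ φ) (slice' sph_cont θ)
    (sph_dφ θ) (slice' vPh_cont θ) (by rw [hper, hend])

lemma dθ_int (hG : ContDiff ℝ 1 G) (φ : ℝ) :
    ∫ θ in (0:ℝ)..Real.pi, (Real.cos θ * G (sph θ φ) + Real.sin θ * fderiv ℝ G (sph θ φ)
      (vTh θ φ)) = 0 := by
  exact curve_int hG Real.hasDerivAt_sin Real.continuous_cos (c := fun θ => sph θ φ)
    (v := fun θ => vTh θ φ) (slice2' sph_cont φ)
    (fun θ => sph_dθ θ φ) (slice2' vTh_cont φ) (by simp)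

lemma ibp01 (hG : ContDiff ℝ 1 G) :
    sphereIntegral (fun m => fderiv ℝ G m (rotv 0 1 m)) = 0 := by
  rw [sphI_eq]
  have : ∀ θ : ℝ, ∫ φ in (0:ℝ)..(2 * Real.pi),
      fderiv ℝ G (sph θ φ) (rotv 0 1 (sph θ φ)) * Real.sin θ = 0 := by
    intro θ
    have h := dφ_int hG (a := fun _ => 1) (a' := fun _ => 0) (fun φ => hasDerivAt_const φ 1)
      continuous_const rfl θ
    rw [intervalIntegral.integral_mul_const]
    have e : (∫ φ in (0:ℝ)..(2 * Real.pi), fderiv ℝ G (sph θ φ) (rotv 0 1 (sph θ φ))) = 0 := by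
      rw [← h]
      congr 1; ext φ
      rw [zero_mul, zero_add, one_mul]
      congr 1
      ext i; fin_cases i <;> simp [rotv, sph, vPh, vTh]
    rw [e, zero_mul]
  simp [this]

/-- The two rotations moving the pole; `b = a'`, with `a = sin` or `-cos`. -/
lemma ibp_pole (hG : ContDiff ℝ 1 G) (l : Fin 3) {a b : ℝ → ℝ} (ha : ∀ φ, HasDerivAt a (b φ) φ)
    (hb : Continuous b) (hper : a (2 * Real.pi) = a 0)
    (hv : ∀ θ φ : ℝ, Real.sin θ • rotv 2 l (sph θ φ) =
      (Real.sin θ * b φ) • (vTh θ φ)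
      - (Real.cos θ * a φ) • (vPh θ φ)) :
    sphereIntegral (fun m => fderiv ℝ G m (rotv 2 l m)) = 0 := by
  have hac : Continuous a := continuous_iff_continuousAt.2 fun x => (ha x).continuousAt
  let g1 : ℝ → ℝ → ℝ := fun θ φ => (Real.cos θ * G (sph θ φ) + Real.sin θ * fderiv ℝ G (sph θ φ)
      (vTh θ φ)) * b φ
  let g2 : ℝ → ℝ → ℝ := fun θ φ => Real.cos θ * (b φ * G (sph θ φ) + a φ * fderiv ℝ G (sph θ φ)
      (vPh θ φ))
  have hGc : Continuous (fun x : ℝ × ℝ => G (sph x.1 x.2)) := hG.continuous.comp sph_cont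
  have c1 : Continuous (fun x : ℝ × ℝ => g1 x.1 x.2) := by
    have := fd_cont hG (v := fun x => vTh x.1 x.2) vTh_cont
    have h1 : Continuous fun x : ℝ × ℝ => Real.cos x.1 := by fun_prop
    have h2 : Continuous fun x : ℝ × ℝ => Real.sin x.1 := by fun_prop
    exact ((h1.mul hGc).add (h2.mul this)).mul (hb.comp continuous_snd)
  have c2 : Continuous (fun x : ℝ × ℝ => g2 x.1 x.2) := by
    have := fd_cont hG (v := fun x => vPh x.1 x.2) vPh_cont
    have h1 : Continuous fun x : ℝ × ℝ => Real.cos x.1 := by fun_prop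
    exact h1.mul (((hb.comp continuous_snd).mul hGc).add ((hac.comp continuous_snd).mul this))
  have e : ∀ θ φ, fderiv ℝ G (sph θ φ) (rotv 2 l (sph θ φ)) * Real.sin θ = g1 θ φ - g2 θ φ := by
    intro θ φ
    have := congrArg (fderiv ℝ G (sph θ φ)) (hv θ φ)
    rw [map_sub, map_smul, map_smul, map_smul] at this
    simp only [smul_eq_mul] at this
    simp only [g1, g2]
    linarith
  rw [sphI_eq]
  simp only [e]
  have i2 : ∀ θ, ∫ φ in (0:ℝ)..(2 * Real.pi), g2 θ φ = 0 := by
    intro θ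
    simp only [g2]
    rw [intervalIntegral.integral_const_mul, dφ_int hG ha hb hper θ, mul_zero]
  have i1 : ∀ φ, ∫ θ in (0:ℝ)..Real.pi, g1 θ φ = 0 := by
    intro φ
    simp only [g1]
    rw [intervalIntegral.integral_mul_const, dθ_int hG φ, zero_mul]
  have : ∀ θ, ∫ φ in (0:ℝ)..(2 * Real.pi), (g1 θ φ - g2 θ φ) = ∫ φ in (0:ℝ)..(2 * Real.pi), g1 θ φ := by
    intro θ
    rw [intervalIntegral.integral_sub ((slice c1 θ).intervalIntegrable _ _)
      ((slice c2 θ).intervalIntegrable _ _), i2, sub_zero]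
  simp only [this]
  rw [MeasureTheory.intervalIntegral_intervalIntegral_swap]
  · simp [i1]
  · refine (MeasureTheory.IntegrableOn.mono_set (c1.continuousOn.integrableOn_compact
      ((isCompact_uIcc (a := (0:ℝ)) (b := Real.pi)).prod (isCompact_uIcc (a := (0:ℝ)) (b := 2 * Real.pi)))) ?_)
    exact Set.prod_mono Set.uIoc_subset_uIcc Set.uIoc_subset_uIcc

lemma ibp20 (hG : ContDiff ℝ 1 G) :
    sphereIntegral (fun m => fderiv ℝ G m (rotv 2 0 m)) = 0 := by
  refine ibp_pole hG 0 (a := Real.sin) (b := Real.cos) Real.hasDerivAt_sin Real.continuous_cos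
    (by simp) fun θ φ => ?_
  ext i; fin_cases i
  · simp [rotv, sph, vPh, vTh]
    linear_combination (-Real.sin θ * Real.cos θ) * (Real.sin_sq_add_cos_sq φ)
  · simp [rotv, sph, vPh, vTh]; ring
  · simp [rotv, sph, vPh, vTh]; ring

lemma ibp21 (hG : ContDiff ℝ 1 G) :
    sphereIntegral (fun m => fderiv ℝ G m (rotv 2 1 m)) = 0 := by
  refine ibp_pole hG 1 (a := fun φ => -Real.cos φ) (b := Real.sin)
    (fun φ => by have := (Real.hasDerivAt_cos φ).neg; rw [neg_neg] at this; exact this) Real.continuous_sin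
    (by simp) fun θ φ => ?_
  ext i; fin_cases i
  · simp [rotv, sph, vPh, vTh]; ring
  · simp [rotv, sph, vPh, vTh]
    linear_combination (-Real.sin θ * Real.cos θ) * (Real.sin_sq_add_cos_sq φ)
  · simp [rotv, sph, vPh, vTh]; ring

lemma ibp_swap {k l : Fin 3} (h : sphereIntegral (fun m => fderiv ℝ G m (rotv k l m)) = 0) :
    sphereIntegral (fun m => fderiv ℝ G m (rotv l k m)) = 0 := by
  have : ∀ m, fderiv ℝ G m (rotv l k m) = (-1) * fderiv ℝ G m (rotv k l m) := by
    intro m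
    have : rotv l k m = - rotv k l m := by simp [rotv]
    rw [this, map_neg]; ring
  simp only [this]
  rw [sphI_smul, h, mul_zero]

lemma ibp (hG : ContDiff ℝ 1 G) {k l : Fin 3} (h : k ≠ l) :
    sphereIntegral (fun m => fderiv ℝ G m (rotv k l m)) = 0 := by
  fin_cases k <;> fin_cases l
  · exact absurd rfl h
  · exact ibp01 hG
  · exact ibp_swap (ibp20 hG)
  · exact ibp_swap (ibp01 hG)
  · exact absurd rfl h
  · exact ibp_swap (ibp21 hG)
  · exact ibp20 hG
  · exact ibp21 hG
  · exact absurd rfl h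
end IBP

/-- Moments. -/
noncomputable def Mo (μ : Fin 3 → ℝ) (k l n : Fin 3) (p q r : ℕ) : ℝ :=
  sphereIntegral (fun m => m k ^ p * m l ^ q * m n ^ r * Real.exp (∑ j, μ j * (m j) ^ 2))

lemma sum_perm {k l n : Fin 3} (h1 : k ≠ l) (h2 : k ≠ n) (h3 : l ≠ n) (f : Fin 3 → ℝ) :
    ∑ j, f j = f k + f l + f n := by
  rw [Fin.sum_univ_three]
  fin_cases k <;> fin_cases l <;> fin_cases n <;> simp at h1 h2 h3 ⊢ <;> ring

lemma Mo_swap (μ : Fin 3 → ℝ) (k l n : Fin 3) (p q r : ℕ) : Mo μ k l n p q r = Mo μ l k n q p r := by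
  unfold Mo; congr 1; ext m; ring

lemma Mo_split (μ : Fin 3 → ℝ) {k l n : Fin 3} (h1 : k ≠ l) (h2 : k ≠ n) (h3 : l ≠ n) (p q r : ℕ) :
    Mo μ k l n p q r = Mo μ k l n (p + 2) q r + Mo μ k l n p (q + 2) r + Mo μ k l n p q (r + 2) := by
  unfold Mo
  rw [← sphI_add (by fun_prop) (by fun_prop), ← sphI_add (by fun_prop) (by fun_prop)]
  refine sphI_congr fun m hm => ?_
  have := sum_perm h1 h2 h3 (fun j => m j ^ 2)
  rw [Fin.sum_univ_three, hm] at this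
  linear_combination (m k ^ p * m l ^ q * m n ^ r * Real.exp (∑ j, μ j * (m j) ^ 2)) * this

lemma Mo_nonneg (μ : Fin 3 → ℝ) (k l n : Fin 3) (p q r : ℕ) :
    0 ≤ Mo μ k l n (2 * p) (2 * q) (2 * r) := by
  refine sphI_nonneg fun m => ?_
  simp only [pow_mul]
  positivity

lemma Mo_pos (μ : Fin 3 → ℝ) (k l n : Fin 3) : 0 < Mo μ k l n 0 0 0 := by
  refine sphI_pos (by fun_prop) fun m => ?_
  simp only [pow_zero]
  positivity

lemma Mo_ibp (μ : Fin 3 → ℝ) {k l n : Fin 3} (h1 : k ≠ l) (h2 : k ≠ n) (h3 : l ≠ n) (p q : ℕ) :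
    (p + 1) * Mo μ k l n 2 p q - Mo μ k l n 0 (p + 2) q
      = 2 * (μ k - μ l) * Mo μ k l n 2 (p + 2) q := by
  let G : (Fin 3 → ℝ) → ℝ := fun m => m k * m l ^ (p + 1) * m n ^ q *
    Real.exp (μ k * m k ^ 2 + μ l * m l ^ 2 + μ n * m n ^ 2)
  have hG : ContDiff ℝ 1 G := by
    simp only [G]
    fun_prop
  have h := ibp hG h1
  have key : ∀ m, fderiv ℝ G m (rotv k l m) =
      ((p + 1 : ℝ) * (m k ^ 2 * m l ^ p * m n ^ q * Real.exp (∑ j, μ j * (m j) ^ 2)) +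
      (-1) * (m k ^ 0 * m l ^ (p + 2) * m n ^ q * Real.exp (∑ j, μ j * (m j) ^ 2))) +
      (2 * (μ l - μ k)) * (m k ^ 2 * m l ^ (p + 2) * m n ^ q * Real.exp (∑ j, μ j * (m j) ^ 2)) := by
    intro m
    rw [sum_perm h1 h2 h3 (fun j => μ j * (m j) ^ 2)]
    have hd : DifferentiableAt ℝ G m := (hG.differentiable one_ne_zero) m
    have hc : ∀ i, HasDerivAt (fun t : ℝ => (m + t • rotv k l m) i) (rotv k l m i) 0 := by
      intro i
      simpa using ((hasDerivAt_id (0:ℝ)).mul_const (rotv k l m i)).const_add (m i)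
    have vk : rotv k l m k = - m l := by simp [rotv, h1]
    have vl : rotv k l m l = m k := by simp [rotv, h1.symm]
    have vn : rotv k l m n = 0 := by simp [rotv, h2.symm, h3.symm]
    have e1 := (((hc k).mul ((hc l).pow (p + 1))).mul ((hc n).pow q)).mul
      (((((hc k).pow 2).const_mul (μ k)).add (((hc l).pow 2).const_mul (μ l))).add
        (((hc n).pow 2).const_mul (μ n))).exp
    have e2 : HasDerivAt (fun t : ℝ => G (m + t • rotv k l m)) (fderiv ℝ G m (rotv k l m)) 0 := by
      have hl : HasDerivAt (fun t : ℝ => m + t • rotv k l m) (rotv k l m) 0 := by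
        simpa using ((hasDerivAt_id (0:ℝ)).smul_const (rotv k l m)).const_add m
      have : HasFDerivAt G (fderiv ℝ G m) (m + (0:ℝ) • rotv k l m) := by simpa using hd.hasFDerivAt
      exact this.comp_hasDerivAt (0:ℝ) hl
    rw [e2.unique e1]
    simp [vk, vl, vn]
    ring
  simp only [key] at h
  rw [sphI_add (by fun_prop) (by fun_prop), sphI_add (by fun_prop) (by fun_prop),
    sphI_smul, sphI_smul, sphI_smul] at h
  unfold Mo
  linarith

lemma z_eq (μ : Fin 3 → ℝ) (i l n : Fin 3) :
    binghamZ2 μ i = Mo μ i l n 2 0 0 / Mo μ i l n 0 0 0 := by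
  have hp := Mo_pos μ i l n
  unfold binghamZ2 binghamZ
  have e1 : sphereIntegral (fun m => Real.exp (∑ i, μ i * (m i) ^ 2)) = Mo μ i l n 0 0 0 := by
    unfold Mo; simp
  have e2 : sphereIntegral (fun m => (m i) ^ 2 * Real.exp (∑ j, μ j * (m j) ^ 2)) = Mo μ i l n 2 0 0 := by
    unfold Mo; simp
  rw [e1, e2]
  have := Real.pi_pos
  field_simp

lemma z_top (μ : Fin 3 → ℝ) {a i j : Fin 3} (h1 : a ≠ i) (h2 : a ≠ j) (h3 : i ≠ j)
    (hi : μ i ≤ μ a) (hj : μ j ≤ μ a) :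
    |1 / (2 * binghamZ2 μ a)| ≤ 2 := by
  have a1 := Mo_ibp μ h1 h2 h3 0 0
  have a2 := Mo_ibp μ h2 h1 h3.symm 0 0
  have s := Mo_split μ h1 h2 h3 0 0 0
  have n1 := mul_nonneg (sub_nonneg.2 hi) (Mo_nonneg μ a i j 1 1 0)
  have n2 := mul_nonneg (sub_nonneg.2 hj) (Mo_nonneg μ a j i 1 1 0)
  have hp := Mo_pos μ a i j
  have t1 : Mo μ a j i 2 0 0 = Mo μ a i j 2 0 0 := by simp only [Mo, pow_zero]
  have t2 : Mo μ a j i 0 2 0 = Mo μ a i j 0 0 2 := by unfold Mo; congr 1; ext m; ring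
  norm_num at a1 a2 s n1 n2
  have hA : 0 < Mo μ a i j 2 0 0 := by linarith
  rw [z_eq μ a i j, abs_of_nonneg (by positivity)]
  rw [div_le_iff₀ (by positivity)]
  have : 1 / 3 ≤ Mo μ a i j 2 0 0 / Mo μ a i j 0 0 0 := by
    rw [le_div_iff₀ hp]; linarith
  linarith

lemma z_other (μ : Fin 3 → ℝ) {a i j : Fin 3} (h1 : a ≠ i) (h2 : a ≠ j) (h3 : i ≠ j)
    (hi : μ i ≤ μ a) (hj : μ j ≤ μ a) :
    |μ i - μ a + 1 / (2 * binghamZ2 μ i)| ≤ 14 := by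
  -- moments written in the order (a, i, j)
  have r1 : ∀ p q r, Mo μ j i a p q r = Mo μ a i j r q p := by
    intro p q r; unfold Mo; congr 1; ext m; ring
  have r2 : ∀ p q r, Mo μ a j i p q r = Mo μ a i j p r q := by
    intro p q r; unfold Mo; congr 1; ext m; ring
  have r3 : Mo μ i a j 2 0 0 = Mo μ a i j 0 2 0 := Mo_swap _ _ _ _ _ _ _
  have r4 : Mo μ i a j 0 0 0 = Mo μ a i j 0 0 0 := Mo_swap _ _ _ _ _ _ _
  have hp := Mo_pos μ a i j
  have A0 := Mo_ibp μ h1 h2 h3 0 0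
  have A2 := Mo_ibp μ h1 h2 h3 2 0
  have A4 := Mo_ibp μ h1 h2 h3 4 0
  have A22 := Mo_ibp μ h1 h2 h3 2 2
  have J0 := Mo_ibp μ h3.symm h2.symm h1.symm 0 0
  have J2 := Mo_ibp μ h3.symm h2.symm h1.symm 2 0
  have B0 := Mo_ibp μ h2 h1 h3.symm 0 2
  have B2 := Mo_ibp μ h2 h1 h3.symm 2 2
  simp only [r1, r2] at J0 J2 B0 B2
  have S000 := Mo_split μ h1 h2 h3 0 0 0
  have S020 := Mo_split μ h1 h2 h3 0 2 0
  have S040 := Mo_split μ h1 h2 h3 0 4 0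
  have S022 := Mo_split μ h1 h2 h3 0 2 2
  have N := Mo_nonneg μ a i j
  have N020 := N 0 1 0
  have N220 := N 1 1 0
  have N040 := N 0 2 0
  have N022 := N 0 1 1
  have N222 := N 1 1 1
  have N042 := N 0 2 1
  have N024 := N 0 1 2
  have N240 := N 1 2 0
  have N060 := N 0 3 0
  have N260 := N 1 3 0
  have N242 := N 1 2 1
  have N224 := N 1 1 2
  norm_num at A0 A2 A4 A22 J0 J2 B0 B2 S000 S020 S040 S022 N020 N220 N040 N022 N222 N042 N024 N240 N060 N260 N242 N224
  rw [z_eq μ i a j, r3, r4]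
  obtain ⟨L, hL⟩ : ∃ L, L = μ a - μ i := ⟨_, rfl⟩
  obtain ⟨D, hD⟩ : ∃ D, D = μ a - μ j := ⟨_, rfl⟩
  have hLD : μ j - μ i = L - D := by rw [hL, hD]; ring
  have hL0 : 0 ≤ L := by linarith
  have hD0 : 0 ≤ D := by linarith
  rw [← hL] at A0 A2 A4 A22
  rw [← hD] at B0 B2
  rw [hLD] at J0 J2
  have e : μ i - μ a = -L := by rw [hL]; ring
  rw [e]
  generalize Mo μ a i j = M at *
  -- δ E[m_i² m_j²] ≤ 7/2 z_i
  have d1 : D * M 2 2 2 ≤ M 0 2 0 / 2 := by linarith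
  have d2 : M 0 2 4 ≤ 3 * M 2 2 2 := by linarith [mul_nonneg hD0 N224]
  have d3 : M 0 4 2 ≤ 3 * M 2 2 2 := by linarith [mul_nonneg hL0 N242]
  have d2' := mul_le_mul_of_nonneg_left d2 hD0
  have d3' := mul_le_mul_of_nonneg_left d3 hD0
  have d4 : D * M 0 2 2 ≤ 7 / 2 * M 0 2 0 := by rw [S022]; linarith
  -- λ E[m_i⁴] ≤ 12 z_i
  have l1 : L * M 2 4 0 ≤ 3 / 2 * M 0 2 0 := by linarith
  have l2 : M 0 6 0 ≤ 5 * M 2 4 0 := by linarith [mul_nonneg hL0 N260]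
  have l2' := mul_le_mul_of_nonneg_left l2 hL0
  have l3 : (L - D) * M 0 4 2 ≤ 3 / 2 * M 0 2 0 := by linarith
  have l4 : L * M 0 4 0 ≤ 12 * M 0 2 0 := by rw [S040]; linarith
  have main : L * M 0 2 0 - M 0 0 0 / 2 = -(3 / 2) * M 0 2 0 + D * M 0 2 2 + L * M 0 4 0 := by
    linear_combination L * S020 - A0 / 2 - J0 / 2 - S000 / 2
  have n1 := mul_nonneg hD0 N022
  have n2 := mul_nonneg hL0 N040
  have hz : 0 < M 0 2 0 := by
    rcases N020.lt_or_eq with h | h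
    · exact h
    · exfalso; rw [← h] at main d4 l4; linarith
  have e2 : -L + 1 / (2 * (M 0 2 0 / M 0 0 0)) = (M 0 0 0 / 2 - L * M 0 2 0) / M 0 2 0 := by
    field_simp
    ring
  rw [e2, abs_le, le_div_iff₀ hz, div_le_iff₀ hz]
  constructor <;> linarith

lemma exists_perm (a : Fin 3) : ∃ i j : Fin 3, a ≠ i ∧ a ≠ j ∧ i ≠ j := by
  revert a; decide

lemma exists_third : ∀ a i : Fin 3, a ≠ i → ∃ j : Fin 3, a ≠ j ∧ i ≠ j := by
  decide

/-- The component differences of the gradient of the correction term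
`ΔS = S − Ŝ` of the 3D entropy decomposition, expressed in `μ`, are uniformly
bounded: `|(μᵢ + 1/(2zᵢ(μ))) − (μⱼ + 1/(2zⱼ(μ)))| ≤ C` for all `μ` and `i, j`. -/
theorem grad_correction_3d_uniformly_bounded :
    ∃ C : ℝ, 0 < C ∧ ∀ (μ : Fin 3 → ℝ) (i j : Fin 3),
      |(μ i + 1 / (2 * binghamZ2 μ i)) - (μ j + 1 / (2 * binghamZ2 μ j))| ≤ C := by
  obtain main : ∀ (μ : Fin 3 → ℝ), ∃ c : ℝ, ∀ i, |μ i - c + 1 / (2 * binghamZ2 μ i)| ≤ 14 := by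
    intro μ
    obtain ⟨a, ha⟩ := Finite.exists_max μ
    refine ⟨μ a, fun i => ?_⟩
    by_cases h : a = i
    · subst h
      obtain ⟨i, j, h1, h2, h3⟩ := exists_perm a
      have := z_top μ h1 h2 h3 (ha i) (ha j)
      rw [sub_self, zero_add]
      linarith
    · obtain ⟨j, h2, h3⟩ := exists_third a i h
      exact z_other μ h h2 h3 (ha i) (ha j)
  refine ⟨28, by norm_num, fun μ i j => ?_⟩
  obtain ⟨c, hc⟩ := main μ
  have h1 := abs_le.1 (hc i)
  have h2 := abs_le.1 (hc j)
  rw [abs_le]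
  constructor <;> linarith [h1.1, h1.2, h2.1, h2.2]
end

section
/- Fix β ≥ 0, set q̃ = I₁(β)/(2 I₀(β)), and for λ > 0 set μ(λ) = (0, −2β, −β − λ/2) ∈ ℝ³. Then lim_{λ→+∞} [ Σᵢ μᵢ(λ) zᵢ(μ(λ)) − ln Z(μ(λ)) + (1/2) ln( z₁(μ(λ)) z₂(μ(λ)) z₃(μ(λ)) ) ] = 2β q̃ − ln I₀(β) + (1/2) ln((1/2 + q̃)(1/2 − q̃)) − (1 + ln(π/2))/2. (The three-dimensional entropy correction term ΔS, evaluated along a degenerating family of Bingham exponents, converges to the two-dimensional correction term minus the constant (1 + ln(π/2))/2; this is Theorem 3.2(i).) -/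
open Real Filter

/-- The modified Bessel function of integer order `n`:
`Iₙ(μ) = (1/(2π)) ∫₀^{2π} e^{μ cos θ} cos (n θ) dθ`. -/
noncomputable def besselI (n : ℤ) (μ : ℝ) : ℝ :=
  (1 / (2 * Real.pi)) * ∫ θ in (0:ℝ)..(2 * Real.pi),
    Real.exp (μ * Real.cos θ) * Real.cos ((n : ℝ) * θ)

lemma aux_int_sq : MeasureTheory.Integrable (fun x : ℝ => x ^ 2 * Real.exp (-x ^ 2)) := by
  have h := integrable_rpow_mul_exp_neg_mul_sq (b := 1) one_pos (s := 2) (by norm_num)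
  simpa using h

lemma aux_int_exp : MeasureTheory.Integrable (fun x : ℝ => Real.exp (-x ^ 2)) := by
  simpa using integrable_exp_neg_mul_sq (b := 1) one_pos

lemma aux_gauss : ∫ x : ℝ, Real.exp (-x ^ 2) = √π := by
  simpa using integral_gaussian 1

lemma aux_gauss_sq : ∫ x : ℝ, x ^ 2 * Real.exp (-x ^ 2) = √π / 2 := by
  have h := MeasureTheory.integral_mul_deriv_eq_deriv_mul_of_integrable
    (u := fun x : ℝ => x) (u' := fun _ => 1)
    (v := fun x : ℝ => -(1/2) * Real.exp (-x ^ 2)) (v' := fun x => x * Real.exp (-x ^ 2))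
    (fun x _ => hasDerivAt_id x)
    (fun x _ => by
      have := ((((hasDerivAt_id x).pow 2).neg).exp).const_mul (-(1/2) : ℝ)
      convert this using 1
      · rfl
      change x * Real.exp (-x ^ 2) = -(1/2) * (Real.exp (-x ^ 2) * -(((2:ℕ):ℝ) * x ^ (2 - 1) * 1))
      push_cast; ring)
    (by
      convert aux_int_sq using 2 with x
      simp; ring)
    (by
      convert aux_int_exp.const_mul (-(1/2) : ℝ) using 2 with x
      simp)
    (by
      have := (integrable_mul_exp_neg_mul_sq (b := 1) one_pos).const_mul (-(1/2) : ℝ)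
      convert this using 2 with x
      simp; ring)
  have e : (fun x : ℝ => x ^ 2 * Real.exp (-x ^ 2)) = fun x => x * (x * Real.exp (-x ^ 2)) := by
    ext x; ring
  rw [e, h]
  simp only [one_mul]
  rw [MeasureTheory.integral_const_mul, aux_gauss]
  ring

lemma aux_lap (p G : ℝ → ℝ) (hp : Continuous p) (hG : Continuous G)
    (hi : MeasureTheory.Integrable (fun x : ℝ => p x * Real.exp (-x ^ 2))) :
    Tendsto (fun r : ℝ => r * ∫ t in (-1:ℝ)..1, p (r * t) * Real.exp (-(r * t) ^ 2) * G t)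
      atTop (nhds ((∫ x : ℝ, p x * Real.exp (-x ^ 2)) * G 0)) := by
  obtain ⟨C, hC⟩ := (isCompact_Icc (a := (-1:ℝ)) (b := 1)).exists_bound_of_continuousOn
    hG.continuousOn
  have hC0 : 0 ≤ C := (norm_nonneg _).trans (hC 0 (by simp))
  have key : Tendsto (fun r : ℝ => ∫ u, (Set.Ioc (-r) r).indicator
      (fun u => p u * Real.exp (-u ^ 2) * G (u / r)) u)
      atTop (nhds (∫ x : ℝ, p x * Real.exp (-x ^ 2) * G 0)) := by
    apply MeasureTheory.tendsto_integral_filter_of_dominated_convergence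
      (fun u => ‖p u * Real.exp (-u ^ 2)‖ * C)
    · filter_upwards with r
      apply MeasureTheory.AEStronglyMeasurable.indicator _ measurableSet_Ioc
      apply Continuous.aestronglyMeasurable
      fun_prop
    · filter_upwards [eventually_gt_atTop 0] with r hr
      filter_upwards with u
      by_cases hu : u ∈ Set.Ioc (-r) r
      · rw [Set.indicator_of_mem hu, norm_mul]
        gcongr
        apply hC
        rw [Set.mem_Icc, le_div_iff₀ hr, div_le_iff₀ hr]
        constructor <;> linarith [hu.1, hu.2]
      · rw [Set.indicator_of_notMem hu, norm_zero]
        positivity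
    · exact hi.norm.mul_const C
    · filter_upwards with u
      have h1 : Tendsto (fun r : ℝ => p u * Real.exp (-u ^ 2) * G (u / r)) atTop
          (nhds (p u * Real.exp (-u ^ 2) * G 0)) := by
        apply Tendsto.const_mul
        exact (hG.tendsto 0).comp (tendsto_const_nhds.div_atTop tendsto_id)
      refine h1.congr' ?_
      filter_upwards [eventually_gt_atTop |u|] with r hr
      rw [Set.indicator_of_mem]
      have := abs_lt.1 hr
      exact ⟨this.1, this.2.le⟩
  rw [MeasureTheory.integral_mul_const] at key
  refine key.congr' ?_
  filter_upwards [eventually_gt_atTop 0] with r hr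
  rw [MeasureTheory.integral_indicator measurableSet_Ioc,
    ← intervalIntegral.integral_of_le (by linarith)]
  have := intervalIntegral.mul_integral_comp_mul_left (a := -1) (b := 1)
    (f := fun u => p u * Real.exp (-u ^ 2) * G (u / r)) r
  simp only [mul_neg, mul_one] at this
  rw [← this]
  congr 1
  apply intervalIntegral.integral_congr
  intro t _
  simp only
  rw [mul_div_cancel_left₀ _ hr.ne']

lemma aux_sphere (f : (Fin 3 → ℝ) → ℝ) (w : ℝ → ℝ → ℝ) (hw : Continuous (Function.uncurry w))
    (h : ∀ θ φ : ℝ, f ![Real.sin θ * Real.cos φ, Real.sin θ * Real.sin φ, Real.cos θ]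
      = w (Real.cos θ) φ) :
    sphereIntegral f = ∫ t in (-1:ℝ)..1, ∫ φ in (0:ℝ)..(2 * Real.pi), w t φ := by
  unfold sphereIntegral
  simp only [h, intervalIntegral.integral_mul_const]
  have hc : Continuous (fun t => ∫ φ in (0:ℝ)..(2 * Real.pi), w t φ) :=
    intervalIntegral.continuous_parametric_intervalIntegral_of_continuous' hw _ _
  have := intervalIntegral.integral_comp_mul_deriv (a := 0) (b := Real.pi)
    (f := Real.cos) (f' := fun x => -Real.sin x)
    (g := fun t => ∫ φ in (0:ℝ)..(2 * Real.pi), w t φ)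
    (fun x _ => Real.hasDerivAt_cos x) (by fun_prop) hc
  simp only [Function.comp, mul_neg, intervalIntegral.integral_neg, Real.cos_zero,
    Real.cos_pi] at this
  rw [intervalIntegral.integral_symm 1 (-1), ← this]
  ring

/-- angular integral -/
noncomputable def auxG (β : ℝ) (a : ℝ → ℝ → ℝ) (t : ℝ) : ℝ :=
  ∫ φ in (0:ℝ)..(2 * Real.pi), a t φ * Real.exp (-2 * β * ((1 - t ^ 2) * Real.sin φ ^ 2))

lemma auxG_cont (β : ℝ) (a : ℝ → ℝ → ℝ) (ha : Continuous (Function.uncurry a)) :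
    Continuous (auxG β a) := by
  unfold auxG
  apply intervalIntegral.continuous_parametric_intervalIntegral_of_continuous'
  have : Continuous (fun x : ℝ × ℝ => a x.1 x.2) := ha
  unfold Function.uncurry
  fun_prop

lemma aux_sphere2 (β s : ℝ) (g : (Fin 3 → ℝ) → ℝ) (b : ℝ → ℝ) (a : ℝ → ℝ → ℝ)
    (ha : Continuous (Function.uncurry a)) (hb : Continuous b)
    (h : ∀ θ φ : ℝ, g ![Real.sin θ * Real.cos φ, Real.sin θ * Real.sin φ, Real.cos θ]
      = b (Real.cos θ) * a (Real.cos θ) φ) :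
    sphereIntegral (fun m => g m * Real.exp (∑ j, (![0, -2 * β, -s] : Fin 3 → ℝ) j * (m j) ^ 2))
      = ∫ t in (-1:ℝ)..1, b t * Real.exp (- (s * t ^ 2)) * auxG β a t := by
  have ha' : Continuous (fun x : ℝ × ℝ => a x.1 x.2) := ha
  rw [aux_sphere _ (fun t φ => b t * Real.exp (- (s * t ^ 2)) *
    (a t φ * Real.exp (-2 * β * ((1 - t ^ 2) * Real.sin φ ^ 2))))]
  · simp only [intervalIntegral.integral_const_mul, auxG]
  · unfold Function.uncurry
    fun_prop
  · intro θ φ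
    rw [h]
    simp only [Fin.sum_univ_three, Matrix.cons_val_zero, Matrix.cons_val_one, Matrix.cons_val]
    rw [← Real.sin_sq, show 0 * (Real.sin θ * Real.cos φ) ^ 2
      + -2 * β * (Real.sin θ * Real.sin φ) ^ 2 + -s * Real.cos θ ^ 2
      = -(s * Real.cos θ ^ 2) + -2 * β * (Real.sin θ ^ 2 * Real.sin φ ^ 2) by ring, Real.exp_add]
    ring

lemma aux_double (f : ℝ → ℝ) (hf : Continuous f) :
    ∫ φ in (0:ℝ)..(2 * Real.pi), f (Real.cos (2 * φ))
      = ∫ φ in (0:ℝ)..(2 * Real.pi), f (Real.cos φ) := by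
  have h := intervalIntegral.mul_integral_comp_mul_left (a := 0) (b := 2 * Real.pi)
    (f := fun x => f (Real.cos x)) 2
  have hper : Function.Periodic (fun x => f (Real.cos x)) (2 * Real.pi) := by
    intro x; simp
  have h2 := hper.intervalIntegral_add_eq (2 * Real.pi) 0
  have hc : Continuous (fun x => f (Real.cos x)) := by fun_prop
  have h3 := intervalIntegral.integral_add_adjacent_intervals
    (hc.intervalIntegrable (μ := MeasureTheory.volume) 0 (2 * Real.pi))
    (hc.intervalIntegrable (μ := MeasureTheory.volume) (2 * Real.pi) (2 * Real.pi + 2 * Real.pi))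
  rw [zero_add] at h2
  rw [mul_zero, show 2 * (2 * Real.pi) = 2 * Real.pi + 2 * Real.pi by ring, ← h3, h2] at h
  linarith

lemma aux_A (β : ℝ) : auxG β (fun _ _ => 1) 0 = 2 * π * Real.exp (-β) * besselI 0 β := by
  have h := aux_double (fun x => Real.exp (-β) * Real.exp (β * x)) (by fun_prop)
  unfold auxG besselI
  simp only [Int.cast_zero, zero_mul, Real.cos_zero, mul_one, one_mul]
  rw [intervalIntegral.integral_const_mul (Real.exp (-β)) (fun φ => Real.exp (β * Real.cos φ))] at h
  have e : ∀ φ : ℝ, Real.exp (-2 * β * ((1 - 0 ^ 2) * Real.sin φ ^ 2))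
      = Real.exp (-β) * Real.exp (β * Real.cos (2 * φ)) := by
    intro φ
    rw [← Real.exp_add, Real.cos_two_mul, Real.sin_sq]; congr 1; ring
  simp only [e]
  rw [h]
  have := Real.pi_pos
  field_simp

lemma aux_sub (β : ℝ) : auxG β (fun t φ => (1 - t ^ 2) * Real.cos φ ^ 2) 0
      - auxG β (fun t φ => (1 - t ^ 2) * Real.sin φ ^ 2) 0
      = 2 * π * Real.exp (-β) * besselI 1 β := by
  have h := aux_double (fun x => Real.exp (-β) * (Real.exp (β * x) * x)) (by fun_prop)
  unfold auxG besselI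
  rw [← intervalIntegral.integral_sub (Continuous.intervalIntegrable (by fun_prop) _ _)
    (Continuous.intervalIntegrable (by fun_prop) _ _)]
  simp only [Int.cast_one, one_mul]
  rw [intervalIntegral.integral_const_mul (Real.exp (-β))
    (fun φ => Real.exp (β * Real.cos φ) * Real.cos φ)] at h
  have e : ∀ φ : ℝ, (1 - 0 ^ 2) * Real.cos φ ^ 2 * Real.exp (-2 * β * ((1 - 0 ^ 2) * Real.sin φ ^ 2))
      - (1 - 0 ^ 2) * Real.sin φ ^ 2 * Real.exp (-2 * β * ((1 - 0 ^ 2) * Real.sin φ ^ 2))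
      = Real.exp (-β) * (Real.exp (β * Real.cos (2 * φ)) * Real.cos (2 * φ)) := by
    intro φ
    rw [← mul_assoc (Real.exp (-β)), ← Real.exp_add, Real.cos_two_mul, Real.sin_sq,
      show -β + β * (2 * Real.cos φ ^ 2 - 1) = -2 * β * ((1 - 0 ^ 2) * (1 - Real.cos φ ^ 2)) by ring]
    ring
  simp only [e]
  rw [h]
  have := Real.pi_pos
  field_simp

lemma aux_add (β : ℝ) : auxG β (fun t φ => (1 - t ^ 2) * Real.cos φ ^ 2) 0
      + auxG β (fun t φ => (1 - t ^ 2) * Real.sin φ ^ 2) 0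
      = auxG β (fun _ _ => 1) 0 := by
  unfold auxG
  rw [← intervalIntegral.integral_add (Continuous.intervalIntegrable (by fun_prop) _ _)
    (Continuous.intervalIntegrable (by fun_prop) _ _)]
  apply intervalIntegral.integral_congr
  intro φ _
  simp only [Real.cos_sq']
  ring

lemma aux_pos_s15 (β : ℝ) (a : ℝ → ℝ → ℝ) (ha : Continuous (a 0)) (h0 : ∀ φ, 0 ≤ a 0 φ)
    (c : ℝ) (hc : c ∈ Set.Icc 0 (2 * π)) (h1 : 0 < a 0 c) : 0 < auxG β a 0 := by
  unfold auxG
  apply intervalIntegral.integral_pos (by positivity) (by fun_prop)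
  · intro x _
    have := h0 x
    positivity
  · exact ⟨c, hc, by positivity⟩

/-- radial integral -/
noncomputable def auxH (b G : ℝ → ℝ) (s : ℝ) : ℝ :=
  ∫ t in (-1:ℝ)..1, b t * Real.exp (- (s * t ^ 2)) * G t

lemma auxH_zero (G : ℝ → ℝ) (hG : Continuous G) :
    Tendsto (fun s : ℝ => √s * auxH (fun _ => 1) G s) atTop (nhds (√π * G 0)) := by
  have := (aux_lap (fun _ => 1) G (by fun_prop) hG (by simpa using aux_int_exp)).comp
    Real.tendsto_sqrt_atTop
  simp only [one_mul, aux_gauss] at this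
  refine this.congr' ?_
  filter_upwards [eventually_gt_atTop 0] with s hs
  simp only [Function.comp, auxH, mul_pow, Real.sq_sqrt hs.le, one_mul]

lemma auxH_two (G : ℝ → ℝ) (hG : Continuous G) :
    Tendsto (fun s : ℝ => √s * (s * auxH (fun t => t ^ 2) G s)) atTop
      (nhds (√π / 2 * G 0)) := by
  have := (aux_lap (fun x => x ^ 2) G (by fun_prop) hG aux_int_sq).comp
    Real.tendsto_sqrt_atTop
  simp only [aux_gauss_sq] at this
  refine this.congr' ?_
  filter_upwards [eventually_gt_atTop 0] with s hs
  simp only [Function.comp, auxH, mul_pow, Real.sq_sqrt hs.le]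
  rw [← intervalIntegral.integral_const_mul s]
  simp only [mul_assoc]

/-- The 3D entropy correction term, evaluated along the degenerating family
`μ(λ) = (0, −2β, −β − λ/2)`, converges as `λ → +∞` to the 2D correction term
minus the constant `(1 + ln(π/2))/2` (Theorem 3.2(i)). -/
theorem correction_3d_degenerates_to_2d (β : ℝ) (hβ : 0 ≤ β) :
    Tendsto (fun lam : ℝ =>
        (∑ i, (![0, -2 * β, -β - lam / 2] : Fin 3 → ℝ) i *
            binghamZ2 ![0, -2 * β, -β - lam / 2] i)
          - Real.log (binghamZ ![0, -2 * β, -β - lam / 2])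
          + (1/2) * Real.log (binghamZ2 ![0, -2 * β, -β - lam / 2] 0 *
              binghamZ2 ![0, -2 * β, -β - lam / 2] 1 *
              binghamZ2 ![0, -2 * β, -β - lam / 2] 2))
      atTop
      (nhds (2 * β * (besselI 1 β / (2 * besselI 0 β)) - Real.log (besselI 0 β)
        + (1/2) * Real.log ((1/2 + besselI 1 β / (2 * besselI 0 β)) *
            (1/2 - besselI 1 β / (2 * besselI 0 β)))
        - (1 + Real.log (Real.pi / 2)) / 2)) := by
  set A := auxG β (fun _ _ => 1) with hA
  set B := auxG β (fun t φ => (1 - t ^ 2) * Real.cos φ ^ 2) with hB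
  set D := auxG β (fun t φ => (1 - t ^ 2) * Real.sin φ ^ 2) with hD
  have cA : Continuous A := auxG_cont _ _ (by fun_prop)
  have cB : Continuous B := auxG_cont _ _ (by unfold Function.uncurry; fun_prop)
  have cD : Continuous D := auxG_cont _ _ (by unfold Function.uncurry; fun_prop)
  have pA : 0 < A 0 := aux_pos_s15 _ _ (by fun_prop) (fun _ => zero_le_one) 0
    ⟨le_rfl, by positivity⟩ one_pos
  have pB : 0 < B 0 := aux_pos_s15 _ _ (by fun_prop) (fun _ => by simp; positivity) 0
    ⟨le_rfl, by positivity⟩ (by simp)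
  have pD : 0 < D 0 := aux_pos_s15 _ _ (by fun_prop) (fun _ => by simp; positivity) (π / 2)
    ⟨by positivity, by linarith [Real.pi_pos]⟩ (by simp)
  have eA : A 0 = 2 * π * Real.exp (-β) * besselI 0 β := aux_A β
  have eS : B 0 - D 0 = 2 * π * Real.exp (-β) * besselI 1 β := aux_sub β
  have eT : B 0 + D 0 = A 0 := aux_add β
  -- reduction to one-variable integrals
  have hZ : ∀ s : ℝ, binghamZ ![0, -2 * β, -s] = 1 / (4 * π) * auxH (fun _ => 1) A s := by
    intro s
    unfold binghamZ
    have := aux_sphere2 β s (fun _ => 1) (fun _ => 1) (fun _ _ => 1) (by fun_prop) (by fun_prop)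
      (by intros; simp)
    simp only [one_mul] at this
    rw [this]; simp [auxH, hA]
  have hZ2 : ∀ s x : ℝ, 1 / (4 * π * binghamZ ![0, -2 * β, -s]) * x
      = x / auxH (fun _ => 1) A s := by
    intro s x
    rw [hZ, ← mul_assoc, mul_one_div_cancel (by positivity), one_mul]; ring
  have h0 : ∀ s : ℝ, binghamZ2 ![0, -2 * β, -s] 0
      = auxH (fun _ => 1) B s / auxH (fun _ => 1) A s := by
    intro s
    unfold binghamZ2
    rw [hZ2, aux_sphere2 β s (fun m => m 0 ^ 2) (fun _ => 1)
      (fun t φ => (1 - t ^ 2) * Real.cos φ ^ 2) (by unfold Function.uncurry; fun_prop) (by fun_prop)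
      (by intro θ φ; simp [← Real.sin_sq, mul_pow])]
    rfl
  have h1 : ∀ s : ℝ, binghamZ2 ![0, -2 * β, -s] 1
      = auxH (fun _ => 1) D s / auxH (fun _ => 1) A s := by
    intro s
    unfold binghamZ2
    rw [hZ2, aux_sphere2 β s (fun m => m 1 ^ 2) (fun _ => 1)
      (fun t φ => (1 - t ^ 2) * Real.sin φ ^ 2) (by unfold Function.uncurry; fun_prop) (by fun_prop)
      (by intro θ φ; simp [← Real.sin_sq, mul_pow])]
    rfl
  have h2 : ∀ s : ℝ, binghamZ2 ![0, -2 * β, -s] 2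
      = auxH (fun t => t ^ 2) A s / auxH (fun _ => 1) A s := by
    intro s
    unfold binghamZ2
    rw [hZ2, aux_sphere2 β s (fun m => m 2 ^ 2) (fun t => t ^ 2)
      (fun _ _ => 1) (by fun_prop) (by fun_prop)
      (by intro θ φ; simp)]
    rfl
  -- limits
  have sp : 0 < √π := by positivity
  have tA := auxH_zero A cA
  have tB := auxH_zero B cB
  have tD := auxH_zero D cD
  have tE := auxH_two A cA
  have nA : √π * A 0 ≠ 0 := by positivity
  have t0 : Tendsto (fun s => binghamZ2 ![0, -2 * β, -s] 0) atTop (nhds (B 0 / A 0)) := by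
    have := tB.div tA nA
    rw [mul_div_mul_left _ _ sp.ne'] at this
    refine this.congr' ?_
    filter_upwards [eventually_gt_atTop 0] with s hs
    have : √s ≠ 0 := by positivity
    rw [h0, Pi.div_apply, mul_div_mul_left _ _ this]
  have t1 : Tendsto (fun s => binghamZ2 ![0, -2 * β, -s] 1) atTop (nhds (D 0 / A 0)) := by
    have := tD.div tA nA
    rw [mul_div_mul_left _ _ sp.ne'] at this
    refine this.congr' ?_
    filter_upwards [eventually_gt_atTop 0] with s hs
    have : √s ≠ 0 := by positivity
    rw [h1, Pi.div_apply, mul_div_mul_left _ _ this]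
  have t2 : Tendsto (fun s => s * binghamZ2 ![0, -2 * β, -s] 2) atTop (nhds (1 / 2)) := by
    have := tE.div tA nA
    rw [show √π / 2 * A 0 / (√π * A 0) = 1 / 2 by field_simp] at this
    refine this.congr' ?_
    filter_upwards [eventually_gt_atTop 0] with s hs
    have : √s ≠ 0 := by positivity
    rw [h2, Pi.div_apply, mul_div_mul_left _ _ this, mul_div_assoc]
  have tZ : Tendsto (fun s => √s * binghamZ ![0, -2 * β, -s]) atTop
      (nhds (1 / (4 * π) * (√π * A 0))) := by
    refine (tA.const_mul (1 / (4 * π))).congr fun s => ?_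
    rw [hZ]; ring
  have nZ : 1 / (4 * π) * (√π * A 0) ≠ 0 := by positivity
  have tP := (t0.mul t1).mul t2
  have nP : B 0 / A 0 * (D 0 / A 0) * (1 / 2) ≠ 0 := by positivity
  have lim := (((t1.const_mul (-2 * β)).sub t2).sub (tZ.log nZ)).add
    ((tP.log nP).const_mul (1 / 2))
  have ts : Tendsto (fun lam : ℝ => β + lam / 2) atTop atTop :=
    tendsto_atTop_add_const_left _ _ (tendsto_id.atTop_div_const (by norm_num))
  have main : Tendsto (fun s : ℝ =>
        (∑ i, (![0, -2 * β, -s] : Fin 3 → ℝ) i * binghamZ2 ![0, -2 * β, -s] i)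
          - Real.log (binghamZ ![0, -2 * β, -s])
          + (1/2) * Real.log (binghamZ2 ![0, -2 * β, -s] 0 *
              binghamZ2 ![0, -2 * β, -s] 1 *
              binghamZ2 ![0, -2 * β, -s] 2)) atTop
      (nhds (-2 * β * (D 0 / A 0) - 1 / 2 - Real.log (1 / (4 * π) * (√π * A 0))
        + 1 / 2 * Real.log (B 0 / A 0 * (D 0 / A 0) * (1 / 2)))) := by
    refine lim.congr' ?_
    filter_upwards [eventually_gt_atTop 0, tZ.eventually_ne nZ, tP.eventually_ne nP] with s hs z p
    have q : binghamZ2 ![0, -2 * β, -s] 0 * binghamZ2 ![0, -2 * β, -s] 1 *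
              binghamZ2 ![0, -2 * β, -s] 2 ≠ 0 := by
      intro h; apply p; linear_combination s * h
    rw [show binghamZ2 ![0, -2 * β, -s] 0 * binghamZ2 ![0, -2 * β, -s] 1 *
      (s * binghamZ2 ![0, -2 * β, -s] 2) = s * (binghamZ2 ![0, -2 * β, -s] 0 *
      binghamZ2 ![0, -2 * β, -s] 1 * binghamZ2 ![0, -2 * β, -s] 2) by ring,
      Real.log_mul hs.ne' q, Real.log_mul (left_ne_zero_of_mul z) (right_ne_zero_of_mul z),
      Real.log_sqrt hs.le]
    simp only [Fin.sum_univ_three, Matrix.cons_val_zero, Matrix.cons_val_one, Matrix.cons_val]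
    ring
  have fin := main.comp ts
  have pI : 0 < besselI 0 β := by
    rw [eA] at pA
    exact pos_of_mul_pos_right pA (by positivity)
  have hq : besselI 1 β / (2 * besselI 0 β) = (B 0 - D 0) / (2 * A 0) := by
    rw [eS, eA]
    have := Real.exp_pos (-β)
    field_simp
  have hb : 1 / 2 + besselI 1 β / (2 * besselI 0 β) = B 0 / A 0 := by
    rw [hq]; field_simp; linarith
  have hd : 1 / 2 - besselI 1 β / (2 * besselI 0 β) = D 0 / A 0 := by
    rw [hq]; field_simp; linarith
  have hval : -2 * β * (D 0 / A 0) - 1 / 2 - Real.log (1 / (4 * π) * (√π * A 0))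
        + 1 / 2 * Real.log (B 0 / A 0 * (D 0 / A 0) * (1 / 2))
      = 2 * β * (besselI 1 β / (2 * besselI 0 β)) - Real.log (besselI 0 β)
        + (1/2) * Real.log ((1/2 + besselI 1 β / (2 * besselI 0 β)) *
            (1/2 - besselI 1 β / (2 * besselI 0 β)))
        - (1 + Real.log (Real.pi / 2)) / 2 := by
    rw [hb, hd, Real.log_mul (by positivity) (by norm_num : (1/2 : ℝ) ≠ 0)]
    have l1 : Real.log (1 / (4 * π) * (√π * A 0))
        = 1 / 2 * Real.log π - Real.log 2 - β + Real.log (besselI 0 β) := by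
      rw [eA, show 1 / (4 * π) * (√π * (2 * π * Real.exp (-β) * besselI 0 β))
        = √π / 2 * Real.exp (-β) * besselI 0 β by field_simp; norm_num]
      rw [Real.log_mul (by positivity) pI.ne', Real.log_mul (by positivity) (by positivity),
        Real.log_div sp.ne' (by norm_num), Real.log_exp, Real.log_sqrt (by positivity)]
      ring
    rw [l1, Real.log_div Real.pi_ne_zero (by norm_num), Real.log_div one_ne_zero (by norm_num),
      Real.log_one, ← hd]
    ring
  rw [← hval]
  refine fin.congr fun lam => ?_
  simp only [Function.comp]
  rw [show -(β + lam / 2) = -β - lam / 2 by ring]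
end
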